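/- Let N ≥ 2, n ≥ 1, and let Q_r ⊂ ℝ^N be a set of r ≥ 1 distinct points. Then for every d ≥ 0 the group H_d(Conf_n(ℝ^N ∖ Q_r); ℤ) is free abelian, it vanishes unless d = j(N−1) for some 0 ≤ j ≤ n, and Σ_{j=0}^n rank H_{j(N−1)}(Conf_n(ℝ^N ∖ Q_r); ℤ) · t^j = (1+rt)(1+(r+1)t)⋯(1+(n+r−1)t); that is, rank H_{j(N−1)} equals the elementary symmetric polynomial e_j evaluated at (r, r+1, …, n+r−1). -/

import Mathlib

/-!
STATEMENT 18: For N ≥ 2, n ≥ 1 and a set Q_r of r ≥ 1 distinct points of ℝ^N,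
the homology of Conf_n(ℝ^N ∖ Q_r) is free, concentrated in degrees j(N−1) for
0 ≤ j ≤ n, with Poincaré polynomial (in t = t^{N−1})
(1+rt)(1+(r+1)t)⋯(1+(n+r−1)t).
-/

open CategoryTheory

/-- Singular homology with integer coefficients, as a functor. -/
noncomputable def singularHomologyFunctor (d : ℕ) : TopCat ⥤ ModuleCat ℤ :=
  TopCat.toSSet ⋙ ((SimplicialObject.whiskering _ _).obj (ModuleCat.free ℤ)) ⋙
    AlgebraicTopology.alternatingFaceMapComplex (ModuleCat ℤ) ⋙
    HomologicalComplex.homologyFunctor (ModuleCat ℤ) (ComplexShape.down ℕ) d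

/-- `SH d X` is the `d`-th integral singular homology group of `X`. -/
noncomputable abbrev SH (d : ℕ) (X : Type) [TopologicalSpace X] : ModuleCat ℤ :=
  (singularHomologyFunctor d).obj (TopCat.of X)

/-- The ordered configuration space of `n` points in `ℝ^N ∖ Q_r`, where
`Q_r` is the range of the injective map `q : Fin r → ℝ^N`. -/
abbrev confComplement (n r N : ℕ) (q : Fin r → EuclideanSpace ℝ (Fin N)) : Type :=
  {x : Fin n → {y : EuclideanSpace ℝ (Fin N) // y ∉ Set.range q} //
    ∀ i j : Fin n, i ≠ j → x i ≠ x j}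

section LinearChains

variable {K L : Type}

/-- The augmented boundary operator on chains of ordered simplices with vertices in `K`. -/
noncomputable def vertexBoundary (n : ℕ) :
    ((Fin (n + 1) → K) →₀ ℤ) →ₗ[ℤ] ((Fin n → K) →₀ ℤ) :=
  ∑ i : Fin (n + 1), (-1 : ℤ) ^ (i : ℕ) • Finsupp.lmapDomain ℤ ℤ (fun w => w ∘ i.succAbove)

/-- Adjoin the vertex `x` in front of every simplex. -/
noncomputable def vertexCone (x : K) (n : ℕ) :
    ((Fin n → K) →₀ ℤ) →ₗ[ℤ] ((Fin (n + 1) → K) →₀ ℤ) :=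
  Finsupp.lmapDomain ℤ ℤ (fun w => Fin.cons x w)

/-- Apply a map to all vertices. -/
noncomputable def vertexMap (f : K → L) (n : ℕ) :
    ((Fin n → K) →₀ ℤ) →ₗ[ℤ] ((Fin n → L) →₀ ℤ) :=
  Finsupp.lmapDomain ℤ ℤ (fun w => f ∘ w)

@[simp] lemma vertexCone_single (x : K) (n : ℕ) (w : Fin n → K) (a : ℤ) :
    vertexCone x n (Finsupp.single w a) = Finsupp.single (Fin.cons x w) a := by
  simp [vertexCone, Finsupp.lmapDomain_apply, Finsupp.mapDomain_single]

@[simp] lemma vertexMap_single (f : K → L) (n : ℕ) (w : Fin n → K) (a : ℤ) :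
    vertexMap f n (Finsupp.single w a) = Finsupp.single (f ∘ w) a := by
  simp [vertexMap, Finsupp.lmapDomain_apply, Finsupp.mapDomain_single]

lemma vertexBoundary_single (n : ℕ) (w : Fin (n + 1) → K) (a : ℤ) :
    vertexBoundary n (Finsupp.single w a) =
      ∑ i : Fin (n + 1), (-1 : ℤ) ^ (i : ℕ) • Finsupp.single (w ∘ i.succAbove) a := by
  simp only [vertexBoundary, LinearMap.sum_apply, LinearMap.smul_apply, Finsupp.lmapDomain_apply,
    Finsupp.mapDomain_single]

lemma vertexBoundary_cone_zero (x : K) (c : (Fin 0 → K) →₀ ℤ) :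
    vertexBoundary 0 (vertexCone x 0 c) = c := by
  induction c using Finsupp.induction_linear with
  | zero => simp
  | add f g hf hg => simp [hf, hg]
  | single w a =>
    simp only [vertexCone_single, vertexBoundary_single]
    rw [Fin.sum_univ_succ, Fin.sum_univ_zero, add_zero, Fin.val_zero, pow_zero, one_smul]
    congr 1

lemma vertexBoundary_cone (x : K) (n : ℕ) (c : (Fin (n + 1) → K) →₀ ℤ) :
    vertexBoundary (n + 1) (vertexCone x (n + 1) c) = c - vertexCone x n (vertexBoundary n c) := by
  induction c using Finsupp.induction_linear with
  | zero => simp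
  | add f g hf hg => simp only [map_add, hf, hg]; abel
  | single w a =>
    simp only [vertexCone_single, vertexBoundary_single, map_sum, map_smul]
    rw [Fin.sum_univ_succ, sub_eq_add_neg, ← Finset.sum_neg_distrib]
    congr 1
    · simp only [Fin.val_zero, pow_zero, one_smul]
      congr 1
    · refine Finset.sum_congr rfl fun i _ => ?_
      rw [Fin.val_succ, pow_succ, mul_neg_one, neg_smul]
      congr 3
      ext j
      refine Fin.cases ?_ (fun j => ?_) j
      · simp
      · simp

lemma linearMap_ext_single {M : Type*} [AddCommGroup M] {A : Type*} {f g : (A →₀ ℤ) →ₗ[ℤ] M}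
    (h : ∀ a, f (Finsupp.single a 1) = g (Finsupp.single a 1)) (c : A →₀ ℤ) : f c = g c := by
  have : f = g := by
    ext a
    simpa using h a
  rw [this]

lemma vertexBoundary_boundary (n : ℕ) (c : (Fin (n + 2) → K) →₀ ℤ) :
    vertexBoundary n (vertexBoundary (n + 1) c) = 0 := by
  induction n with
  | zero =>
    refine linearMap_ext_single (f := vertexBoundary 0 ∘ₗ vertexBoundary 1) (g := 0) (fun w => ?_) c
    rw [← Fin.cons_self_tail w, ← vertexCone_single, LinearMap.comp_apply, vertexBoundary_cone,
      map_sub, vertexBoundary_cone_zero, sub_self, LinearMap.zero_apply]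
  | succ n ih =>
    refine linearMap_ext_single (f := vertexBoundary (n + 1) ∘ₗ vertexBoundary (n + 2)) (g := 0)
      (fun w => ?_) c
    rw [← Fin.cons_self_tail w, ← vertexCone_single, LinearMap.comp_apply, vertexBoundary_cone,
      map_sub, vertexBoundary_cone, ih]
    simp

lemma vertexMap_boundary (f : K → L) (n : ℕ) (c : (Fin (n + 1) → K) →₀ ℤ) :
    vertexMap f n (vertexBoundary n c) = vertexBoundary n (vertexMap f (n + 1) c) := by
  refine linearMap_ext_single (f := vertexMap f n ∘ₗ vertexBoundary n)
    (g := vertexBoundary n ∘ₗ vertexMap f (n + 1)) (fun w => ?_) c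
  simp [vertexBoundary_single, Function.comp_assoc]

lemma vertexMap_cone (f : K → L) (x : K) (n : ℕ) (c : (Fin n → K) →₀ ℤ) :
    vertexMap f (n + 1) (vertexCone x n c) = vertexCone (f x) n (vertexMap f n c) := by
  refine linearMap_ext_single (f := vertexMap f (n + 1) ∘ₗ vertexCone x n)
    (g := vertexCone (f x) n ∘ₗ vertexMap f n) (fun w => ?_) c
  simp only [LinearMap.comp_apply, vertexCone_single, vertexMap_single]
  congr 1
  exact (Fin.comp_cons f x w)

/-- Subdivision, given a choice of a new vertex for every simplex. -/
noncomputable def vertexSubdivision (b : ∀ n : ℕ, (Fin (n + 1) → K) → K) :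
    ∀ n : ℕ, ((Fin n → K) →₀ ℤ) →ₗ[ℤ] ((Fin n → K) →₀ ℤ)
  | 0 => LinearMap.id
  | n + 1 => Finsupp.linearCombination ℤ fun v =>
      vertexCone (b n v) n (vertexSubdivision b n (vertexBoundary n (Finsupp.single v 1)))

/-- The chain homotopy between subdivision and the identity. -/
noncomputable def vertexHomotopy (b : ∀ n : ℕ, (Fin (n + 1) → K) → K) :
    ∀ n : ℕ, ((Fin n → K) →₀ ℤ) →ₗ[ℤ] ((Fin (n + 1) → K) →₀ ℤ)
  | 0 => 0
  | n + 1 => Finsupp.linearCombination ℤ fun v =>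
      vertexCone (b n v) (n + 1)
        (Finsupp.single v 1 - vertexHomotopy b n (vertexBoundary n (Finsupp.single v 1)))

variable (b : ∀ n : ℕ, (Fin (n + 1) → K) → K)

lemma vertexSubdivision_succ_single (n : ℕ) (v : Fin (n + 1) → K) :
    vertexSubdivision b (n + 1) (Finsupp.single v 1) =
      vertexCone (b n v) n (vertexSubdivision b n (vertexBoundary n (Finsupp.single v 1))) := by
  simp [vertexSubdivision]

lemma vertexHomotopy_succ_single (n : ℕ) (v : Fin (n + 1) → K) :
    vertexHomotopy b (n + 1) (Finsupp.single v 1) =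
      vertexCone (b n v) (n + 1)
        (Finsupp.single v 1 - vertexHomotopy b n (vertexBoundary n (Finsupp.single v 1))) := by
  simp [vertexHomotopy]

lemma vertexBoundary_subdivision (n : ℕ) (c : (Fin (n + 1) → K) →₀ ℤ) :
    vertexBoundary n (vertexSubdivision b (n + 1) c) =
      vertexSubdivision b n (vertexBoundary n c) := by
  induction n with
  | zero =>
    refine linearMap_ext_single (f := vertexBoundary 0 ∘ₗ vertexSubdivision b 1)
      (g := vertexSubdivision b 0 ∘ₗ vertexBoundary 0) (fun w => ?_) c
    simp only [LinearMap.comp_apply, vertexSubdivision_succ_single, vertexBoundary_cone_zero]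
  | succ n ih =>
    refine linearMap_ext_single (f := vertexBoundary (n + 1) ∘ₗ vertexSubdivision b (n + 2))
      (g := vertexSubdivision b (n + 1) ∘ₗ vertexBoundary (n + 1)) (fun w => ?_) c
    rw [LinearMap.comp_apply, vertexSubdivision_succ_single, vertexBoundary_cone, ih,
      vertexBoundary_boundary]
    simp

lemma vertexBoundary_homotopy (n : ℕ) (c : (Fin (n + 1) → K) →₀ ℤ) :
    vertexBoundary (n + 1) (vertexHomotopy b (n + 1) c) +
      vertexHomotopy b n (vertexBoundary n c) = c - vertexSubdivision b (n + 1) c := by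
  induction n with
  | zero =>
    refine linearMap_ext_single
      (f := vertexBoundary 1 ∘ₗ vertexHomotopy b 1 + vertexHomotopy b 0 ∘ₗ vertexBoundary 0)
      (g := LinearMap.id - vertexSubdivision b 1) (fun w => ?_) c
    simp only [LinearMap.add_apply, LinearMap.sub_apply, LinearMap.comp_apply,
      vertexHomotopy_succ_single, vertexBoundary_cone, vertexSubdivision_succ_single]
    simp [vertexHomotopy, vertexSubdivision]
  | succ n ih =>
    refine linearMap_ext_single
      (f := vertexBoundary (n + 2) ∘ₗ vertexHomotopy b (n + 2) +
        vertexHomotopy b (n + 1) ∘ₗ vertexBoundary (n + 1))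
      (g := LinearMap.id - vertexSubdivision b (n + 2)) (fun w => ?_) c
    simp only [LinearMap.add_apply, LinearMap.sub_apply, LinearMap.comp_apply,
      vertexHomotopy_succ_single (n := n + 1), vertexBoundary_cone,
      vertexSubdivision_succ_single (n := n + 1)]
    have h := ih (vertexBoundary (n + 1) (Finsupp.single w 1))
    rw [vertexBoundary_boundary, map_zero, add_zero] at h
    rw [map_sub (vertexBoundary (n + 1)), h]
    simp only [sub_sub_cancel, LinearMap.id_apply]
    abel

lemma vertexMap_subdivision (f : K → L) (b' : ∀ n : ℕ, (Fin (n + 1) → L) → L)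
    (hf : ∀ n v, f (b n v) = b' n (f ∘ v)) (n : ℕ) (c : (Fin n → K) →₀ ℤ) :
    vertexMap f n (vertexSubdivision b n c) = vertexSubdivision b' n (vertexMap f n c) := by
  induction n with
  | zero => simp [vertexSubdivision]
  | succ n ih =>
    refine linearMap_ext_single (f := vertexMap f (n + 1) ∘ₗ vertexSubdivision b (n + 1))
      (g := vertexSubdivision b' (n + 1) ∘ₗ vertexMap f (n + 1)) (fun w => ?_) c
    simp only [LinearMap.comp_apply, vertexSubdivision_succ_single, vertexMap_cone, ih,
      vertexMap_boundary, vertexMap_single, hf]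

lemma vertexMap_homotopy (f : K → L) (b' : ∀ n : ℕ, (Fin (n + 1) → L) → L)
    (hf : ∀ n v, f (b n v) = b' n (f ∘ v)) (n : ℕ) (c : (Fin n → K) →₀ ℤ) :
    vertexMap f (n + 1) (vertexHomotopy b n c) = vertexHomotopy b' n (vertexMap f n c) := by
  induction n with
  | zero => simp [vertexHomotopy]
  | succ n ih =>
    refine linearMap_ext_single (f := vertexMap f (n + 2) ∘ₗ vertexHomotopy b (n + 1))
      (g := vertexHomotopy b' (n + 1) ∘ₗ vertexMap f (n + 1)) (fun w => ?_) c
    simp only [LinearMap.comp_apply, vertexHomotopy_succ_single, vertexMap_cone, map_sub, ih,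
      vertexMap_boundary, vertexMap_single, hf]

end LinearChains

section AffineSimplices

variable {ι κ μ : Type} [Fintype ι] [Fintype κ] [Fintype μ]

/-- The affine map between standard simplices with prescribed values at the vertices. -/
noncomputable def affineSimplex (w : ι → stdSimplex ℝ κ) :
    C(stdSimplex ℝ ι, stdSimplex ℝ κ) where
  toFun t := ⟨∑ i, t i • (w i : κ → ℝ),
    (convex_stdSimplex ℝ κ).sum_mem (fun i _ => t.2.1 i) t.2.2 (fun i _ => (w i).2)⟩
  continuous_toFun := by
    refine Continuous.subtype_mk (continuous_finsetSum _ fun i _ => ?_) _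
    exact ((continuous_apply i).comp continuous_subtype_val).smul continuous_const

lemma affineSimplex_coe (w : ι → stdSimplex ℝ κ) (t : stdSimplex ℝ ι) :
    (affineSimplex w t : κ → ℝ) = ∑ i, t i • (w i : κ → ℝ) := rfl

lemma affineSimplex_apply (w : ι → stdSimplex ℝ κ) (t : stdSimplex ℝ ι) (k : κ) :
    affineSimplex w t k = ∑ i, t i * w i k := by
  rw [affineSimplex_coe, Finset.sum_apply]
  rfl

lemma affineSimplex_affineSimplex (w : ι → stdSimplex ℝ κ) (u : μ → stdSimplex ℝ ι)
    (t : stdSimplex ℝ μ) :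
    affineSimplex w (affineSimplex u t) = affineSimplex (fun i => affineSimplex w (u i)) t := by
  ext k
  simp only [affineSimplex_apply, Finset.sum_mul, Finset.mul_sum]
  rw [Finset.sum_comm]
  refine Finset.sum_congr rfl fun i _ => Finset.sum_congr rfl fun j _ => by ring

lemma affineSimplex_vertex [DecidableEq ι] (w : ι → stdSimplex ℝ κ) (i : ι) :
    affineSimplex w (stdSimplex.vertex i) = w i := by
  ext k
  simp only [affineSimplex_apply]
  change ∑ j, (Pi.single i (1 : ℝ) : ι → ℝ) j * w j k = _
  simp [Pi.single_apply]

lemma affineSimplex_vertices [DecidableEq ι] (t : stdSimplex ℝ ι) :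
    affineSimplex (fun i => stdSimplex.vertex (S := ℝ) i) t = t := by
  ext k
  simp only [affineSimplex_apply]
  change ∑ i, t i * (Pi.single i (1 : ℝ) : ι → ℝ) k = _
  simp [Pi.single_apply]

lemma affineSimplex_map [DecidableEq ι] (w : ι → stdSimplex ℝ κ) (f : μ → ι) (t : stdSimplex ℝ μ) :
    affineSimplex w (stdSimplex.map f t) = affineSimplex (w ∘ f) t := by
  ext k
  simp only [affineSimplex_apply, Function.comp_apply]
  have : ∀ i, stdSimplex.map f t i = ∑ j with f j = i, t j := by
    intro i
    rw [stdSimplex.map_coe, FunOnFinite.linearMap_apply_apply]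
  simp only [this, Finset.sum_mul]
  rw [← Finset.sum_fiberwise_of_maps_to (s := Finset.univ) (t := Finset.univ) (g := f) (by simp)]
  refine Finset.sum_congr rfl fun i _ => Finset.sum_congr rfl fun j hj => ?_
  rw [(Finset.mem_filter.mp hj).2]

/-- The barycenter of a tuple of points in a simplex. -/
noncomputable def tupleBarycenter (n : ℕ) (v : Fin (n + 1) → stdSimplex ℝ κ) : stdSimplex ℝ κ :=
  affineSimplex v stdSimplex.barycenter

lemma affineSimplex_tupleBarycenter (w : ι → stdSimplex ℝ κ) (n : ℕ)
    (v : Fin (n + 1) → stdSimplex ℝ ι) :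
    affineSimplex w (tupleBarycenter n v) = tupleBarycenter n (affineSimplex w ∘ v) :=
  affineSimplex_affineSimplex _ _ _

lemma dist_affineSimplex_le (v : ι → stdSimplex ℝ κ) (x : stdSimplex ℝ κ) (r : ℝ)
    (h : ∀ i, dist (v i) x ≤ r) (t : stdSimplex ℝ ι) : dist (affineSimplex v t) x ≤ r := by
  have := (convex_closedBall (x : κ → ℝ) r).sum_mem (t := Finset.univ) (w := t)
    (z := fun i => (v i : κ → ℝ)) (fun i _ => t.2.1 i) t.2.2 (fun i _ => h i)
  exact this

lemma dist_tupleBarycenter_le (n : ℕ) (v : Fin (n + 1) → stdSimplex ℝ κ) (D : ℝ)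
    (hD : ∀ i j, dist (v i) (v j) ≤ D) (j : Fin (n + 1)) :
    dist (tupleBarycenter n v) (v j) ≤ n / (n + 1) * D := by
  have hn : (0 : ℝ) < n + 1 := by positivity
  have hb : ∀ i : Fin (n + 1), (stdSimplex.barycenter : stdSimplex ℝ (Fin (n + 1))) i
      = 1 / ((n : ℝ) + 1) := by
    intro i
    change (stdSimplex.barycenter : stdSimplex ℝ (Fin (n + 1))).val i = _
    rw [stdSimplex.barycenter_apply]
    simp
  have key : (tupleBarycenter n v : κ → ℝ) - v j =
      ∑ i ∈ Finset.univ.erase j, (1 / ((n : ℝ) + 1)) • ((v i : κ → ℝ) - v j) := by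
    have h1 : ∑ i, (1 / ((n : ℝ) + 1)) • ((v i : κ → ℝ) - v j) =
        ∑ i ∈ Finset.univ.erase j, (1 / ((n : ℝ) + 1)) • ((v i : κ → ℝ) - v j) := by
      rw [← Finset.add_sum_erase _ _ (Finset.mem_univ j)]
      simp
    rw [← h1, tupleBarycenter, affineSimplex_coe]
    simp only [hb, smul_sub, Finset.sum_sub_distrib]
    congr 1
    rw [Finset.sum_const, Finset.card_univ, Fintype.card_fin, ← Nat.cast_smul_eq_nsmul ℝ, smul_smul]
    push_cast
    rw [mul_one_div_cancel hn.ne', one_smul]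
  rw [Subtype.dist_eq, dist_eq_norm]
  change ‖(tupleBarycenter n v : κ → ℝ) - v j‖ ≤ _
  rw [key]
  refine (norm_sum_le _ _).trans ?_
  have : ∀ i ∈ Finset.univ.erase j,
      ‖(1 / ((n : ℝ) + 1)) • ((v i : κ → ℝ) - v j)‖ ≤ 1 / ((n : ℝ) + 1) * D := by
    intro i _
    rw [norm_smul, Real.norm_of_nonneg (by positivity), ← dist_eq_norm]
    exact mul_le_mul_of_nonneg_left (hD i j) (by positivity)
  refine (Finset.sum_le_card_nsmul _ _ _ this).trans_eq ?_
  rw [Finset.card_erase_of_mem (Finset.mem_univ j), Finset.card_univ, Fintype.card_fin]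
  simp
  ring

lemma vertexBoundary_single_mem {K : Type} (n : ℕ) (w : Fin (n + 1) → K)
    (S : Submodule ℤ ((Fin n → K) →₀ ℤ))
    (h : ∀ i : Fin (n + 1), Finsupp.single (w ∘ i.succAbove) 1 ∈ S) :
    vertexBoundary n (Finsupp.single w 1) ∈ S := by
  rw [vertexBoundary_single]
  exact Submodule.sum_mem _ fun i _ => Submodule.smul_mem _ _ (h i)

lemma vertexSubdivision_single_mem (N n : ℕ) (hn : n ≤ N + 1) (v : Fin n → stdSimplex ℝ κ) (D : ℝ)
    (hD0 : 0 ≤ D) (hD : ∀ i j, dist (v i) (v j) ≤ D) :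
    vertexSubdivision tupleBarycenter n (Finsupp.single v 1) ∈ Finsupp.supported ℤ ℤ
      {w | (∀ i, ∃ t, w i = affineSimplex v t) ∧ ∀ i j, dist (w i) (w j) ≤ (N / (N + 1) : ℝ) * D} := by
  induction n with
  | zero =>
    simp only [vertexSubdivision, LinearMap.id_apply]
    exact Finsupp.single_mem_supported ℤ _ ⟨fun i => i.elim0, fun i => i.elim0⟩
  | succ n ih =>
    rw [vertexSubdivision_succ_single]
    have hc : (n / (n + 1) : ℝ) ≤ N / (N + 1) := by
      rw [div_le_div_iff₀ (by positivity) (by positivity)]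
      have : (n : ℝ) ≤ N := by exact_mod_cast (by omega : n ≤ N)
      nlinarith
    have hface : vertexSubdivision tupleBarycenter n (vertexBoundary n (Finsupp.single v 1)) ∈
        Finsupp.supported ℤ ℤ {w | (∀ i, ∃ t, w i = affineSimplex v t) ∧
          ∀ i j, dist (w i) (w j) ≤ (N / (N + 1) : ℝ) * D} := by
      rw [← Submodule.mem_comap]
      refine vertexBoundary_single_mem _ _ _ fun i => ?_
      rw [Submodule.mem_comap]
      refine Finsupp.supported_mono ?_ (ih (by omega) (v ∘ i.succAbove) fun _ _ => hD _ _)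
      rintro w ⟨h1, h2⟩
      refine ⟨fun j => ?_, h2⟩
      obtain ⟨t, ht⟩ := h1 j
      exact ⟨stdSimplex.map i.succAbove t, by rw [affineSimplex_map, ht]⟩
    have hb : ∀ t, dist (affineSimplex v t) (tupleBarycenter n v) ≤ (N / (N + 1) : ℝ) * D := by
      intro t
      refine dist_affineSimplex_le _ _ _ (fun i => ?_) t
      rw [dist_comm]
      exact (dist_tupleBarycenter_le n v D hD i).trans (mul_le_mul_of_nonneg_right hc hD0)
    have hmap := Finsupp.lmapDomain_supported (R := ℤ) (M := ℤ)
      (fun w : Fin n → stdSimplex ℝ κ =>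
        (Fin.cons (tupleBarycenter n v) w : Fin (n + 1) → stdSimplex ℝ κ))
      {w | (∀ i, ∃ t, w i = affineSimplex v t) ∧
          ∀ i j, dist (w i) (w j) ≤ (N / (N + 1) : ℝ) * D}
    have h2 := hmap.le (Submodule.mem_map_of_mem hface)
    refine Finsupp.supported_mono ?_ h2
    rintro _ ⟨w, ⟨h1, h2⟩, rfl⟩
    have h0 : 0 ≤ (N / (N + 1) : ℝ) * D := by positivity
    refine ⟨fun i => ?_, fun i j => ?_⟩
    · refine Fin.cases ⟨stdSimplex.barycenter, rfl⟩ (fun i => ?_) i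
      simpa using h1 i
    · refine Fin.cases ?_ (fun i => ?_) i <;> refine Fin.cases ?_ (fun j => ?_) j
      · simpa using h0
      · obtain ⟨t, ht⟩ := h1 j
        simp only [Fin.cons_zero, Fin.cons_succ]
        rw [dist_comm, ht]
        exact hb t
      · obtain ⟨t, ht⟩ := h1 i
        simp only [Fin.cons_zero, Fin.cons_succ]
        rw [ht]
        exact hb t
      · simpa using h2 i j

lemma iterate_vertexSubdivision_single_mem (n : ℕ) (v : Fin (n + 1) → stdSimplex ℝ κ) (D : ℝ)
    (hD0 : 0 ≤ D) (hD : ∀ i j, dist (v i) (v j) ≤ D) (m : ℕ) :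
    (vertexSubdivision tupleBarycenter (n + 1) ^ m) (Finsupp.single v 1) ∈
      Finsupp.supported ℤ ℤ {w | ∀ i j, dist (w i) (w j) ≤ (n / (n + 1) : ℝ) ^ m * D} := by
  induction m with
  | zero =>
    simp only [pow_zero, Module.End.one_apply, one_mul]
    exact Finsupp.single_mem_supported ℤ _ hD
  | succ m ih =>
    have hpow : vertexSubdivision (tupleBarycenter (κ := κ)) (n + 1) ^ (m + 1) =
      vertexSubdivision tupleBarycenter (n + 1) *
        vertexSubdivision tupleBarycenter (n + 1) ^ m := pow_succ' _ _
    rw [hpow, Module.End.mul_apply, ← Submodule.mem_comap]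
    refine SetLike.le_def.mp ?_ ih
    rw [Finsupp.supported_eq_span_single, Submodule.span_le]
    rintro _ ⟨w, hw, rfl⟩
    refine Finsupp.supported_mono ?_ (vertexSubdivision_single_mem n (n + 1) le_rfl w _
      (by positivity) hw)
    rintro u ⟨-, hu⟩ i j
    refine (hu i j).trans_eq ?_
    ring

end AffineSimplices

section SingularChains

variable {X Y : Type} [TopologicalSpace X] [TopologicalSpace Y]

/-- The `i`-th face of a singular simplex. -/
noncomputable def singularFace {n : ℕ} (i : Fin (n + 2))
    (σ : C(stdSimplex ℝ (Fin (n + 2)), X)) : C(stdSimplex ℝ (Fin (n + 1)), X) :=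
  σ.comp ⟨stdSimplex.map i.succAbove, stdSimplex.continuous_map _⟩

/-- The singular boundary operator. -/
noncomputable def singularBoundary (X : Type) [TopologicalSpace X] (n : ℕ) :
    (C(stdSimplex ℝ (Fin (n + 2)), X) →₀ ℤ) →ₗ[ℤ] (C(stdSimplex ℝ (Fin (n + 1)), X) →₀ ℤ) :=
  ∑ i : Fin (n + 2), (-1 : ℤ) ^ (i : ℕ) • Finsupp.lmapDomain ℤ ℤ (singularFace i)

lemma singularBoundary_single (n : ℕ) (σ : C(stdSimplex ℝ (Fin (n + 2)), X)) (a : ℤ) :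
    singularBoundary X n (Finsupp.single σ a) =
      ∑ i : Fin (n + 2), (-1 : ℤ) ^ (i : ℕ) • Finsupp.single (singularFace i σ) a := by
  simp only [singularBoundary, LinearMap.sum_apply, LinearMap.smul_apply,
    Finsupp.lmapDomain_apply, Finsupp.mapDomain_single]

/-- Pushing tuples of points of a simplex to affine singular simplices. -/
noncomputable def affineChain {n : ℕ} (σ : C(stdSimplex ℝ (Fin (n + 1)), X)) (m : ℕ) :
    ((Fin (m + 1) → stdSimplex ℝ (Fin (n + 1))) →₀ ℤ) →ₗ[ℤ]
      (C(stdSimplex ℝ (Fin (m + 1)), X) →₀ ℤ) :=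
  Finsupp.lmapDomain ℤ ℤ fun w => σ.comp (affineSimplex w)

@[simp] lemma affineChain_single {n : ℕ} (σ : C(stdSimplex ℝ (Fin (n + 1)), X)) (m : ℕ)
    (w : Fin (m + 1) → stdSimplex ℝ (Fin (n + 1))) (a : ℤ) :
    affineChain σ m (Finsupp.single w a) = Finsupp.single (σ.comp (affineSimplex w)) a := by
  simp [affineChain, Finsupp.lmapDomain_apply, Finsupp.mapDomain_single]

lemma singularBoundary_affineChain {n : ℕ} (σ : C(stdSimplex ℝ (Fin (n + 1)), X)) (m : ℕ)
    (c : (Fin (m + 2) → stdSimplex ℝ (Fin (n + 1))) →₀ ℤ) :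
    singularBoundary X m (affineChain σ (m + 1) c) =
      affineChain σ m (vertexBoundary (m + 1) c) := by
  refine linearMap_ext_single (f := singularBoundary X m ∘ₗ affineChain σ (m + 1))
    (g := affineChain σ m ∘ₗ vertexBoundary (m + 1)) (fun w => ?_) c
  simp only [LinearMap.comp_apply, affineChain_single, singularBoundary_single,
    vertexBoundary_single, map_sum, map_smul]
  refine Finset.sum_congr rfl fun i _ => ?_
  congr 2
  ext t
  simp only [singularFace, ContinuousMap.comp_apply, ContinuousMap.coe_mk, affineSimplex_map]

lemma affineChain_comp {n m : ℕ} (σ : C(stdSimplex ℝ (Fin (n + 1)), X))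
    (w : Fin (m + 1) → stdSimplex ℝ (Fin (n + 1))) (k : ℕ)
    (c : (Fin (k + 1) → stdSimplex ℝ (Fin (m + 1))) →₀ ℤ) :
    affineChain (σ.comp (affineSimplex w)) k c =
      affineChain σ k (vertexMap (affineSimplex w) (k + 1) c) := by
  refine linearMap_ext_single (f := affineChain (σ.comp (affineSimplex w)) k)
    (g := affineChain σ k ∘ₗ vertexMap (affineSimplex w) (k + 1)) (fun u => ?_) c
  simp only [LinearMap.comp_apply, affineChain_single, vertexMap_single]
  congr 1
  ext t
  exact congrArg σ (affineSimplex_affineSimplex w u t)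

/-- The fundamental simplex, as a tuple of vertices. -/
noncomputable def vertexTuple (n : ℕ) : Fin (n + 1) → stdSimplex ℝ (Fin (n + 1)) :=
  fun i => stdSimplex.vertex i

lemma affineChain_vertexTuple {n : ℕ} (σ : C(stdSimplex ℝ (Fin (n + 1)), X)) (a : ℤ) :
    affineChain σ n (Finsupp.single (vertexTuple n) a) = Finsupp.single σ a := by
  rw [affineChain_single]
  congr 1
  ext t
  exact congrArg σ (affineSimplex_vertices t)

/-- Barycentric subdivision of singular chains. -/
noncomputable def singularSubdivision (X : Type) [TopologicalSpace X] (n : ℕ) :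
    (C(stdSimplex ℝ (Fin (n + 1)), X) →₀ ℤ) →ₗ[ℤ] (C(stdSimplex ℝ (Fin (n + 1)), X) →₀ ℤ) :=
  Finsupp.linearCombination ℤ fun σ =>
    affineChain σ n (vertexSubdivision tupleBarycenter (n + 1) (Finsupp.single (vertexTuple n) 1))

/-- The chain homotopy between barycentric subdivision and the identity. -/
noncomputable def singularHomotopy (X : Type) [TopologicalSpace X] (n : ℕ) :
    (C(stdSimplex ℝ (Fin (n + 1)), X) →₀ ℤ) →ₗ[ℤ] (C(stdSimplex ℝ (Fin (n + 2)), X) →₀ ℤ) :=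
  Finsupp.linearCombination ℤ fun σ =>
    affineChain σ (n + 1)
      (vertexHomotopy tupleBarycenter (n + 1) (Finsupp.single (vertexTuple n) 1))

lemma vertexMap_vertexTuple {n m : ℕ} (w : Fin (m + 1) → stdSimplex ℝ (Fin (n + 1))) :
    affineSimplex w ∘ vertexTuple m = w := by
  ext1 i
  exact affineSimplex_vertex w i

lemma singularSubdivision_affineChain {n : ℕ} (σ : C(stdSimplex ℝ (Fin (n + 1)), X)) (m : ℕ)
    (c : (Fin (m + 1) → stdSimplex ℝ (Fin (n + 1))) →₀ ℤ) :
    singularSubdivision X m (affineChain σ m c) =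
      affineChain σ m (vertexSubdivision tupleBarycenter (m + 1) c) := by
  refine linearMap_ext_single (f := singularSubdivision X m ∘ₗ affineChain σ m)
    (g := affineChain σ m ∘ₗ vertexSubdivision tupleBarycenter (m + 1)) (fun w => ?_) c
  simp only [LinearMap.comp_apply, affineChain_single]
  rw [singularSubdivision, Finsupp.linearCombination_single, one_smul, affineChain_comp,
    vertexMap_subdivision _ _ tupleBarycenter (affineSimplex_tupleBarycenter w), vertexMap_single,
    vertexMap_vertexTuple]

lemma singularHomotopy_affineChain {n : ℕ} (σ : C(stdSimplex ℝ (Fin (n + 1)), X)) (m : ℕ)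
    (c : (Fin (m + 1) → stdSimplex ℝ (Fin (n + 1))) →₀ ℤ) :
    singularHomotopy X m (affineChain σ m c) =
      affineChain σ (m + 1) (vertexHomotopy tupleBarycenter (m + 1) c) := by
  refine linearMap_ext_single (f := singularHomotopy X m ∘ₗ affineChain σ m)
    (g := affineChain σ (m + 1) ∘ₗ vertexHomotopy tupleBarycenter (m + 1)) (fun w => ?_) c
  simp only [LinearMap.comp_apply, affineChain_single]
  rw [singularHomotopy, Finsupp.linearCombination_single, one_smul, affineChain_comp,
    vertexMap_homotopy _ _ tupleBarycenter (affineSimplex_tupleBarycenter w), vertexMap_single,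
    vertexMap_vertexTuple]

lemma singularBoundary_subdivision (n : ℕ) (c : C(stdSimplex ℝ (Fin (n + 2)), X) →₀ ℤ) :
    singularBoundary X n (singularSubdivision X (n + 1) c) =
      singularSubdivision X n (singularBoundary X n c) := by
  refine linearMap_ext_single (f := singularBoundary X n ∘ₗ singularSubdivision X (n + 1))
    (g := singularSubdivision X n ∘ₗ singularBoundary X n) (fun σ => ?_) c
  simp only [LinearMap.comp_apply]
  rw [← affineChain_vertexTuple, singularSubdivision_affineChain, singularBoundary_affineChain,
    singularBoundary_affineChain, singularSubdivision_affineChain, vertexBoundary_subdivision]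

lemma singularBoundary_homotopy (n : ℕ) (c : C(stdSimplex ℝ (Fin (n + 2)), X) →₀ ℤ) :
    singularBoundary X (n + 1) (singularHomotopy X (n + 1) c) +
      singularHomotopy X n (singularBoundary X n c) = c - singularSubdivision X (n + 1) c := by
  refine linearMap_ext_single
    (f := singularBoundary X (n + 1) ∘ₗ singularHomotopy X (n + 1) +
      singularHomotopy X n ∘ₗ singularBoundary X n)
    (g := LinearMap.id - singularSubdivision X (n + 1)) (fun σ => ?_) c
  simp only [LinearMap.comp_apply, LinearMap.add_apply, LinearMap.sub_apply, LinearMap.id_apply]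
  rw [← affineChain_vertexTuple, singularSubdivision_affineChain, singularHomotopy_affineChain,
    singularBoundary_affineChain, singularBoundary_affineChain, singularHomotopy_affineChain,
    ← map_add, vertexBoundary_homotopy, map_sub]

/-- Chains of singular simplices contained in `U` or in `V`. -/
def smallChains (U V : Set X) (n : ℕ) : Submodule ℤ (C(stdSimplex ℝ (Fin (n + 1)), X) →₀ ℤ) :=
  Finsupp.supported ℤ ℤ {σ | Set.range σ ⊆ U ∨ Set.range σ ⊆ V}

lemma affineChain_mem_smallChains {U V : Set X} {n : ℕ} {σ : C(stdSimplex ℝ (Fin (n + 1)), X)}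
    (hσ : Set.range σ ⊆ U ∨ Set.range σ ⊆ V) (m : ℕ)
    (c : (Fin (m + 1) → stdSimplex ℝ (Fin (n + 1))) →₀ ℤ) :
    affineChain σ m c ∈ smallChains U V m := by
  induction c using Finsupp.induction_linear with
  | zero => simp
  | add f g hf hg => rw [map_add]; exact Submodule.add_mem _ hf hg
  | single w a =>
    rw [affineChain_single]
    refine Finsupp.single_mem_supported ℤ _ ?_
    exact hσ.imp (fun h => (Set.range_comp_subset_range _ σ).trans h)
      (fun h => (Set.range_comp_subset_range _ σ).trans h)

lemma linearCombination_mem_of_supported {A M : Type*} [AddCommGroup M] {s : Set A} {f : A → M}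
    {S : Submodule ℤ M} (hf : ∀ a ∈ s, f a ∈ S) {c : A →₀ ℤ} (hc : c ∈ Finsupp.supported ℤ ℤ s) :
    Finsupp.linearCombination ℤ f c ∈ S := by
  rw [Finsupp.linearCombination_apply]
  exact Submodule.sum_mem _ fun a ha => Submodule.smul_mem _ _ (hf a (hc ha))

lemma singularSubdivision_mem_smallChains {U V : Set X} {n : ℕ}
    {c : C(stdSimplex ℝ (Fin (n + 1)), X) →₀ ℤ} (hc : c ∈ smallChains U V n) :
    singularSubdivision X n c ∈ smallChains U V n :=
  linearCombination_mem_of_supported (fun _ hσ => affineChain_mem_smallChains hσ _ _) hc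

lemma singularHomotopy_mem_smallChains {U V : Set X} {n : ℕ}
    {c : C(stdSimplex ℝ (Fin (n + 1)), X) →₀ ℤ} (hc : c ∈ smallChains U V n) :
    singularHomotopy X n c ∈ smallChains U V (n + 1) :=
  linearCombination_mem_of_supported (fun _ hσ => affineChain_mem_smallChains hσ _ _) hc

lemma singularSubdivision_pow_mem {U V : Set X} {n : ℕ}
    {c : C(stdSimplex ℝ (Fin (n + 1)), X) →₀ ℤ} (hc : c ∈ smallChains U V n) (m : ℕ) :
    (singularSubdivision X n ^ m) c ∈ smallChains U V n := by
  induction m with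
  | zero => simpa using hc
  | succ m ih =>
    rw [pow_succ', Module.End.mul_apply]
    exact singularSubdivision_mem_smallChains ih

lemma singularSubdivision_pow_affineChain {n : ℕ} (σ : C(stdSimplex ℝ (Fin (n + 1)), X)) (m k : ℕ)
    (c : (Fin (m + 1) → stdSimplex ℝ (Fin (n + 1))) →₀ ℤ) :
    (singularSubdivision X m ^ k) (affineChain σ m c) =
      affineChain σ m ((vertexSubdivision tupleBarycenter (m + 1) ^ k) c) := by
  induction k with
  | zero => simp
  | succ k ih =>
    have h1 : singularSubdivision X m ^ (k + 1) =
      singularSubdivision X m * singularSubdivision X m ^ k := pow_succ' _ _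
    have h2 : vertexSubdivision (tupleBarycenter (κ := Fin (n + 1))) (m + 1) ^ (k + 1) =
      vertexSubdivision tupleBarycenter (m + 1) *
        vertexSubdivision tupleBarycenter (m + 1) ^ k := pow_succ' _ _
    rw [h1, h2, Module.End.mul_apply, Module.End.mul_apply, ih, singularSubdivision_affineChain]

lemma exists_subdivision_single_mem {U V : Set X} (hU : IsOpen U) (hV : IsOpen V)
    (hUV : U ∪ V = Set.univ) {n : ℕ} (σ : C(stdSimplex ℝ (Fin (n + 1)), X)) :
    ∃ m, (singularSubdivision X n ^ m) (Finsupp.single σ 1) ∈ smallChains U V n := by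
  obtain ⟨δ, hδ, hball⟩ := lebesgue_number_lemma_of_metric (s := Set.univ)
    (c := fun b : Bool => σ ⁻¹' (cond b U V)) isCompact_univ
    (by
      rintro (_ | _)
      · exact hV.preimage σ.continuous
      · exact hU.preimage σ.continuous)
    (by
      intro t _
      rcases (hUV ▸ Set.mem_univ (σ t) : σ t ∈ U ∪ V) with h | h
      · exact Set.mem_iUnion.mpr ⟨true, h⟩
      · exact Set.mem_iUnion.mpr ⟨false, h⟩)
  have hn : (n / (n + 1) : ℝ) < 1 := by
    rw [div_lt_one (by positivity)]
    linarith
  obtain ⟨D, hD0, hD⟩ : ∃ D : ℝ, 0 ≤ D ∧ ∀ i j, dist (vertexTuple n i) (vertexTuple n j) ≤ D :=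
    ⟨Metric.diam (Set.univ : Set (stdSimplex ℝ (Fin (n + 1)))), Metric.diam_nonneg,
      fun i j => Metric.dist_le_diam_of_mem isCompact_univ.isBounded trivial trivial⟩
  obtain ⟨m, hm⟩ : ∃ m : ℕ, (n / (n + 1) : ℝ) ^ m * D < δ := by
    have h := (tendsto_pow_atTop_nhds_zero_of_lt_one (by positivity) hn).mul_const D
    rw [zero_mul] at h
    exact (h.eventually (gt_mem_nhds hδ)).exists
  refine ⟨m, ?_⟩
  rw [← affineChain_vertexTuple, singularSubdivision_pow_affineChain]
  have h1 := iterate_vertexSubdivision_single_mem n (vertexTuple n) D hD0 hD m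
  have h2 := (Finsupp.lmapDomain_supported (R := ℤ) (M := ℤ)
    (fun w : Fin (n + 1) → stdSimplex ℝ (Fin (n + 1)) => σ.comp (affineSimplex w)) _).le
    (Submodule.mem_map_of_mem h1)
  refine Finsupp.supported_mono ?_ h2
  rintro _ ⟨w, hw, rfl⟩
  obtain ⟨b, hb⟩ := hball (w 0) trivial
  have h3 : Set.range (σ.comp (affineSimplex w)) ⊆ cond b U V := by
    rintro _ ⟨t, rfl⟩
    refine hb (a := affineSimplex w t) ?_
    exact (dist_affineSimplex_le w (w 0) _ (fun i => hw i 0) t).trans_lt hm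
  cases b
  · exact Or.inr h3
  · exact Or.inl h3

lemma exists_subdivision_mem {U V : Set X} (hU : IsOpen U) (hV : IsOpen V)
    (hUV : U ∪ V = Set.univ) {n : ℕ} (c : C(stdSimplex ℝ (Fin (n + 1)), X) →₀ ℤ) :
    ∃ m, (singularSubdivision X n ^ m) c ∈ smallChains U V n := by
  induction c using Finsupp.induction_linear with
  | zero => exact ⟨0, by simp⟩
  | add f g hf hg =>
    obtain ⟨a, ha⟩ := hf
    obtain ⟨b, hb⟩ := hg
    refine ⟨a + b, ?_⟩
    rw [map_add]
    refine Submodule.add_mem _ ?_ ?_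
    · rw [add_comm a b, pow_add, Module.End.mul_apply]
      exact singularSubdivision_pow_mem ha b
    · rw [pow_add, Module.End.mul_apply]
      exact singularSubdivision_pow_mem hb a
  | single σ a =>
    obtain ⟨m, hm⟩ := exists_subdivision_single_mem hU hV hUV σ
    refine ⟨m, ?_⟩
    rw [← mul_one a, ← smul_eq_mul, ← Finsupp.smul_single, map_smul]
    exact Submodule.smul_mem _ _ hm

/-- A chain whose boundary is small is homologous to a small chain. -/
theorem exists_sub_boundary_mem_smallChains {U V : Set X} (hU : IsOpen U) (hV : IsOpen V)
    (hUV : U ∪ V = Set.univ) {n : ℕ} (c : C(stdSimplex ℝ (Fin (n + 2)), X) →₀ ℤ)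
    (hc : singularBoundary X n c ∈ smallChains U V n) :
    ∃ e, c - singularBoundary X (n + 1) e ∈ smallChains U V (n + 1) := by
  obtain ⟨m, hm⟩ := exists_subdivision_mem hU hV hUV c
  induction m generalizing c with
  | zero => exact ⟨0, by simpa using hm⟩
  | succ m ih =>
    rw [pow_succ, Module.End.mul_apply] at hm
    obtain ⟨e, he⟩ := ih (singularSubdivision X (n + 1) c)
      (by rw [singularBoundary_subdivision]; exact singularSubdivision_mem_smallChains hc) hm
    refine ⟨e + singularHomotopy X (n + 1) c, ?_⟩
    have h := singularBoundary_homotopy n c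
    have : c - singularBoundary X (n + 1) (e + singularHomotopy X (n + 1) c) =
        (singularSubdivision X (n + 1) c - singularBoundary X (n + 1) e) +
          singularHomotopy X n (singularBoundary X n c) := by
      rw [map_add, sub_add_eq_sub_sub, ← sub_eq_zero]
      rw [← sub_eq_zero] at h
      rw [← neg_eq_zero, ← h]
      abel
    rw [this]
    exact Submodule.add_mem _ he (singularHomotopy_mem_smallChains hc)

theorem mem_smallChains_zero {U V : Set X} (hUV : U ∪ V = Set.univ)
    (c : C(stdSimplex ℝ (Fin 1), X) →₀ ℤ) : c ∈ smallChains U V 0 := by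
  intro σ _
  rcases (hUV ▸ Set.mem_univ (σ default) : σ default ∈ U ∪ V) with h | h
  · refine Or.inl ?_
    rintro _ ⟨t, rfl⟩
    rwa [Subsingleton.elim t default]
  · refine Or.inr ?_
    rintro _ ⟨t, rfl⟩
    rwa [Subsingleton.elim t default]

end SingularChains

section SingularDifferential

/-- The boundary operator, including the zero map out of degree `0`. -/
noncomputable def singularDifferential (X : Type) [TopologicalSpace X] : (n : ℕ) →
    (C(stdSimplex ℝ (Fin (n + 1)), X) →₀ ℤ) →ₗ[ℤ] (C(stdSimplex ℝ (Fin (n - 1 + 1)), X) →₀ ℤ)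
  | 0 => 0
  | n + 1 => singularBoundary X n

end SingularDifferential

section SingularHomology

open CategoryTheory Simplicial Opposite

/-- The integral singular chain complex, as a functor. -/
noncomputable def singularChainFunctor : TopCat ⥤ ChainComplex (ModuleCat ℤ) ℕ :=
  TopCat.toSSet ⋙ ((SimplicialObject.whiskering _ _).obj (ModuleCat.free ℤ)) ⋙
    AlgebraicTopology.alternatingFaceMapComplex (ModuleCat ℤ)

variable {X Y : Type} [TopologicalSpace X] [TopologicalSpace Y]

/-- The singular chain complex of a space. -/
noncomputable abbrev singularComplex (X : Type) [TopologicalSpace X] :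
    ChainComplex (ModuleCat ℤ) ℕ :=
  singularChainFunctor.obj (TopCat.of X)

/-- Singular chains are formal combinations of singular simplices. -/
noncomputable def singularChainEquiv (X : Type) [TopologicalSpace X] (n : ℕ) :
    (singularComplex X).X n ≃ₗ[ℤ] (C(stdSimplex ℝ (Fin (n + 1)), X) →₀ ℤ) :=
  Finsupp.domLCongr (TopCat.toSSetObjEquiv (TopCat.of X) (op ⦋n⦌))

lemma singularChainEquiv_freeMk (n : ℕ) (x : (TopCat.toSSet.obj (TopCat.of X)).obj (op ⦋n⦌)) :
    singularChainEquiv X n (ModuleCat.freeMk x) =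
      Finsupp.single (TopCat.toSSetObjEquiv (TopCat.of X) (op ⦋n⦌) x) 1 :=
  Finsupp.domLCongr_single _ _ _

lemma moduleCat_sum_zsmul_apply {M N : ModuleCat ℤ} {k : ℕ} (a : Fin k → ℤ) (f : Fin k → (M ⟶ N))
    (x : M) : (∑ i, a i • f i : M ⟶ N).hom x = ∑ i, a i • (f i).hom x := by
  simp [ModuleCat.hom_sum, LinearMap.sum_apply]

lemma singularChainEquiv_d (n : ℕ) (x : (singularComplex X).X (n + 1)) :
    singularChainEquiv X n ((singularComplex X).d (n + 1) n x) =
      singularBoundary X n (singularChainEquiv X (n + 1) x) := by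
  have key : (singularChainEquiv X n).toLinearMap ∘ₗ ((singularComplex X).d (n + 1) n).hom =
      singularBoundary X n ∘ₗ (singularChainEquiv X (n + 1)).toLinearMap := by
    refine Finsupp.lhom_ext' fun x => LinearMap.ext_ring ?_
    change singularChainEquiv X n (((singularComplex X).d (n + 1) n).hom (ModuleCat.freeMk x)) =
      singularBoundary X n (singularChainEquiv X (n + 1) (ModuleCat.freeMk x))
    rw [singularChainEquiv_freeMk, singularBoundary_single]
    have hd : (singularComplex X).d (n + 1) n =
      ∑ i : Fin (n + 2), (-1 : ℤ) ^ (i : ℕ) •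
        (ModuleCat.free ℤ).map ((TopCat.toSSet.obj (TopCat.of X)).δ i) :=
      AlgebraicTopology.AlternatingFaceMapComplex.obj_d_eq _ _
    have hx : ((singularComplex X).d (n + 1) n).hom (ModuleCat.freeMk x) =
        ∑ i : Fin (n + 2), (-1 : ℤ) ^ (i : ℕ) •
          (ModuleCat.freeMk ((TopCat.toSSet.obj (TopCat.of X)).δ i x) :
            (ModuleCat.free ℤ).obj ((TopCat.toSSet.obj (TopCat.of X)).obj (op ⦋n⦌))) := by
      rw [hd]
      refine (moduleCat_sum_zsmul_apply _ _ _).trans (Finset.sum_congr rfl fun i _ => ?_)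
      exact congrArg ((-1 : ℤ) ^ (i : ℕ) • ·) (ModuleCat.free_map_apply _ x)
    refine (congrArg (singularChainEquiv X n) hx).trans ?_
    refine (map_sum (singularChainEquiv X n) _ _).trans (Finset.sum_congr rfl fun i _ => ?_)
    refine (map_zsmul (singularChainEquiv X n) _ _).trans ?_
    congr 1
    exact singularChainEquiv_freeMk n _
  exact LinearMap.congr_fun key x

lemma singularChainEquiv_map (f : C(X, Y)) (n : ℕ) (x : (singularComplex X).X n) :
    singularChainEquiv Y n ((singularChainFunctor.map (TopCat.ofHom f)).f n x) =
      Finsupp.lmapDomain ℤ ℤ f.comp (singularChainEquiv X n x) := by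
  have key : (singularChainEquiv Y n).toLinearMap ∘ₗ
      ((singularChainFunctor.map (TopCat.ofHom f)).f n).hom =
      Finsupp.lmapDomain ℤ ℤ f.comp ∘ₗ (singularChainEquiv X n).toLinearMap := by
    refine Finsupp.lhom_ext' fun x => LinearMap.ext_ring ?_
    change singularChainEquiv Y n ((ModuleCat.free ℤ).map
      ((TopCat.toSSet.map (TopCat.ofHom f)).app (op ⦋n⦌)) (ModuleCat.freeMk x)) =
      Finsupp.lmapDomain ℤ ℤ f.comp (singularChainEquiv X n (ModuleCat.freeMk x))
    rw [ModuleCat.free_map_apply, singularChainEquiv_freeMk, singularChainEquiv_freeMk,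
      Finsupp.lmapDomain_apply, Finsupp.mapDomain_single]
    rfl
  exact LinearMap.congr_fun key x

/-- The map induced on singular homology by a continuous map. -/
noncomputable def SHmap (d : ℕ) (f : C(X, Y)) : SH d X →ₗ[ℤ] SH d Y :=
  ((singularHomologyFunctor d).map (TopCat.ofHom f)).hom

lemma SHmap_id (d : ℕ) : SHmap d (ContinuousMap.id X) = LinearMap.id := by
  have h : TopCat.ofHom (ContinuousMap.id X) = 𝟙 (TopCat.of X) := rfl
  rw [SHmap, h, CategoryTheory.Functor.map_id]
  rfl

lemma SHmap_comp {Z : Type} [TopologicalSpace Z] (d : ℕ) (g : C(Y, Z)) (f : C(X, Y)) :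
    SHmap d (g.comp f) = SHmap d g ∘ₗ SHmap d f := by
  have h : TopCat.ofHom (g.comp f) = TopCat.ofHom f ≫ TopCat.ofHom g := rfl
  rw [SHmap, h, CategoryTheory.Functor.map_comp]
  rfl

lemma SHmap_eq_of_homotopic (d : ℕ) {f g : C(X, Y)} (h : f.Homotopic g) :
    SHmap d f = SHmap d g := by
  obtain ⟨H⟩ := h
  let H' : TopCat.Homotopy (TopCat.ofHom f) (TopCat.ofHom g) := H
  let K := (H'.toSSet.toSimplicialObjectHomotopy.whiskerRight (ModuleCat.free ℤ)).toChainHomotopy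
  exact congrArg ModuleCat.Hom.hom (K.homologyMap_eq d)

/-- The homology class of a cycle of a short complex of modules. -/
noncomputable def shortComplexClass {R : Type} [Ring R] (S : ShortComplex (ModuleCat.{0} R)) :
    LinearMap.ker S.g.hom →+ S.homology :=
  S.homologyπ.hom.toAddMonoidHom.comp S.moduleCatCyclesIso.inv.hom.toAddMonoidHom

lemma shortComplexClass_surjective {R : Type} [Ring R] (S : ShortComplex (ModuleCat.{0} R)) :
    Function.Surjective (shortComplexClass S) := by
  have h₁ : Function.Surjective S.homologyπ.hom :=
    (ModuleCat.epi_iff_surjective _).1 inferInstance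
  have h₂ : Function.Surjective S.moduleCatCyclesIso.inv.hom :=
    (ModuleCat.epi_iff_surjective _).1 inferInstance
  exact h₁.comp h₂

lemma shortComplexClass_eq_zero_iff {R : Type} [Ring R] (S : ShortComplex (ModuleCat.{0} R))
    (z : LinearMap.ker S.g.hom) :
    shortComplexClass S z = 0 ↔ ∃ e, S.f.hom e = z.1 := by
  have h₁ : Function.Injective S.moduleCatHomologyIso.inv.hom :=
    (ModuleCat.mono_iff_injective _).1 inferInstance
  have h₂ : shortComplexClass S z = S.moduleCatHomologyIso.inv.hom
      ((LinearMap.range S.moduleCatToCycles).mkQ z) :=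
    congrArg (fun φ => ModuleCat.Hom.hom φ z) S.moduleCatCyclesIso_inv_π
  refine (Eq.congr_left h₂).trans ((map_eq_zero_iff _ h₁).trans ?_)
  refine (Submodule.Quotient.mk_eq_zero (LinearMap.range S.moduleCatToCycles)).trans ?_
  exact LinearMap.mem_range.trans (exists_congr fun e => Subtype.ext_iff)

lemma homologyMap_shortComplexClass {R : Type} [Ring R] {S T : ShortComplex (ModuleCat.{0} R)}
    (φ : S ⟶ T) (z : LinearMap.ker S.g.hom) (w : LinearMap.ker T.g.hom) (h : w.1 = φ.τ₂.hom z.1) :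
    (ShortComplex.homologyMap φ).hom (shortComplexClass S z) = shortComplexClass T w := by
  have h₁ : (ShortComplex.cyclesMap φ).hom (S.moduleCatCyclesIso.inv.hom z) =
      T.moduleCatCyclesIso.inv.hom w := by
    apply (ModuleCat.mono_iff_injective T.iCycles).1 inferInstance
    have h₂ := congrArg (fun ψ => ModuleCat.Hom.hom ψ (S.moduleCatCyclesIso.inv.hom z))
      (ShortComplex.cyclesMap_i φ)
    have h₃ := congrArg (fun ψ => ModuleCat.Hom.hom ψ z) S.moduleCatCyclesIso_inv_iCycles
    have h₄ := congrArg (fun ψ => ModuleCat.Hom.hom ψ w) T.moduleCatCyclesIso_inv_iCycles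
    exact (h₂.trans (congrArg φ.τ₂.hom h₃)).trans (h.symm.trans h₄.symm)
  have h₅ := congrArg (fun ψ => ModuleCat.Hom.hom ψ (S.moduleCatCyclesIso.inv.hom z))
    (ShortComplex.homologyπ_naturality φ)
  exact h₅.trans (congrArg T.homologyπ.hom h₁)

lemma mem_ker_singularDifferential_iff (d : ℕ) (x : (singularComplex X).X d) :
    singularChainEquiv X d x ∈ LinearMap.ker (singularDifferential X d) ↔
      x ∈ LinearMap.ker ((singularComplex X).sc d).g.hom := by
  change _ ↔ ((singularComplex X).d d ((ComplexShape.down ℕ).next d)).hom x = 0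
  cases d with
  | zero =>
    rw [(singularComplex X).shape _ _ (by simp)]
    simp [singularDifferential]
  | succ n =>
    rw [ChainComplex.next_nat_succ, LinearMap.mem_ker]
    refine Iff.trans ?_ (singularChainEquiv X n).map_eq_zero_iff
    exact Eq.congr_left (singularChainEquiv_d n x).symm

/-- Cycles of the singular complex are singular cycles. -/
noncomputable def singularCyclesEquiv (X : Type) [TopologicalSpace X] (d : ℕ) :
    LinearMap.ker ((singularComplex X).sc d).g.hom ≃+
      LinearMap.ker (singularDifferential X d) :=
  ((singularChainEquiv X d).ofSubmodules _ _ <| by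
    ext y
    obtain ⟨x, rfl⟩ := (singularChainEquiv X d).surjective y
    refine Iff.trans ?_ (mem_ker_singularDifferential_iff d x).symm
    refine ⟨fun ⟨x', hx', h⟩ => ?_, fun h => ⟨x, h, rfl⟩⟩
    exact (singularChainEquiv X d).injective h ▸ hx').toAddEquiv

/-- The homology class of a cycle. -/
noncomputable def homologyClass (X : Type) [TopologicalSpace X] (d : ℕ) :
    LinearMap.ker (singularDifferential X d) →+ SH d X :=
  (shortComplexClass ((singularComplex X).sc d)).comp (singularCyclesEquiv X d).symm.toAddMonoidHom

lemma homologyClass_surjective (d : ℕ) : Function.Surjective (homologyClass X d) :=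
  (shortComplexClass_surjective _).comp (singularCyclesEquiv X d).symm.surjective

lemma homologyClass_eq_zero_iff (d : ℕ) (z : LinearMap.ker (singularDifferential X d)) :
    homologyClass X d z = 0 ↔ ∃ e, singularBoundary X d e = z.1 := by
  obtain ⟨y, rfl⟩ := (singularCyclesEquiv X d).surjective z
  have h : homologyClass X d (singularCyclesEquiv X d y) = shortComplexClass _ y :=
    congrArg (shortComplexClass _) ((singularCyclesEquiv X d).symm_apply_apply y)
  refine (Eq.congr_left h).trans ((shortComplexClass_eq_zero_iff _ y).trans ?_)
  change (∃ e, ((singularComplex X).d ((ComplexShape.down ℕ).prev d) d).hom e = y.1) ↔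
    ∃ e, singularBoundary X d e = singularChainEquiv X d y.1
  rw [ChainComplex.prev]
  refine Iff.trans (exists_congr fun e => ?_) (singularChainEquiv X (d + 1)).surjective.exists.symm
  exact (singularChainEquiv X d).injective.eq_iff.symm.trans
    (Eq.congr_left (singularChainEquiv_d d e))

lemma SHmap_homologyClass (d : ℕ) (f : C(X, Y)) (z : LinearMap.ker (singularDifferential X d))
    (w : LinearMap.ker (singularDifferential Y d))
    (h : w.1 = Finsupp.lmapDomain ℤ ℤ f.comp z.1) :
    SHmap d f (homologyClass X d z) = homologyClass Y d w := by
  refine homologyMap_shortComplexClass _ _ _ ?_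
  apply (singularChainEquiv Y d).injective
  refine ((singularChainEquiv Y d).apply_symm_apply w.1).trans (h.trans ?_)
  refine Eq.trans ?_ (singularChainEquiv_map f d _).symm
  exact congrArg _ ((singularChainEquiv X d).apply_symm_apply z.1).symm

end SingularHomology

section MayerVietoris

variable {X Y Z : Type} [TopologicalSpace X] [TopologicalSpace Y] [TopologicalSpace Z]

lemma singularBoundary_singularBoundary (n : ℕ) (c : C(stdSimplex ℝ (Fin (n + 3)), X) →₀ ℤ) :
    singularBoundary X n (singularBoundary X (n + 1) c) = 0 := by
  obtain ⟨x, rfl⟩ := (singularChainEquiv X (n + 2)).surjective c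
  refine (congrArg _ (singularChainEquiv_d (n + 1) x).symm).trans ?_
  refine (singularChainEquiv_d n _).symm.trans ?_
  refine (congrArg (singularChainEquiv X n) ?_).trans (map_zero _)
  exact congrArg (fun φ => ModuleCat.Hom.hom φ x) ((singularComplex X).d_comp_d (n + 2) (n + 1) n)

/-- The map induced on singular chains by a continuous map. -/
noncomputable def singularPush (f : C(X, Y)) (n : ℕ) :
    (C(stdSimplex ℝ (Fin (n + 1)), X) →₀ ℤ) →ₗ[ℤ] (C(stdSimplex ℝ (Fin (n + 1)), Y) →₀ ℤ) :=
  Finsupp.lmapDomain ℤ ℤ f.comp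

lemma singularBoundary_push (f : C(X, Y)) (n : ℕ) (c : C(stdSimplex ℝ (Fin (n + 2)), X) →₀ ℤ) :
    singularBoundary Y n (singularPush f (n + 1) c) = singularPush f n (singularBoundary X n c) := by
  obtain ⟨x, rfl⟩ := (singularChainEquiv X (n + 1)).surjective c
  refine (congrArg _ (singularChainEquiv_map f (n + 1) x).symm).trans ?_
  refine (singularChainEquiv_d n _).symm.trans ?_
  refine Eq.trans ?_ ((singularChainEquiv_map f n _).trans
    (congrArg (singularPush f n) (singularChainEquiv_d n x)))
  congr 1
  exact congrArg (fun φ => ModuleCat.Hom.hom φ x)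
    ((singularChainFunctor.map (TopCat.ofHom f)).comm (n + 1) n)

lemma singularPush_push (g : C(Y, Z)) (f : C(X, Y)) (n : ℕ)
    (c : C(stdSimplex ℝ (Fin (n + 1)), X) →₀ ℤ) :
    singularPush g n (singularPush f n c) = singularPush (g.comp f) n c :=
  (Finsupp.mapDomain_comp (f := f.comp) (g := g.comp)).symm

lemma singularPush_injective {f : C(X, Y)} (hf : Function.Injective f) (n : ℕ) :
    Function.Injective (singularPush f n) :=
  Finsupp.mapDomain_injective fun _ _ h =>
    ContinuousMap.ext fun t => hf (congrArg (fun τ => τ t) h)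

lemma singularDifferential_push (f : C(X, Y)) {n : ℕ} {c : C(stdSimplex ℝ (Fin (n + 1)), X) →₀ ℤ}
    (hc : c ∈ LinearMap.ker (singularDifferential X n)) :
    singularPush f n c ∈ LinearMap.ker (singularDifferential Y n) := by
  cases n with
  | zero => exact LinearMap.mem_ker.2 rfl
  | succ n =>
    rw [LinearMap.mem_ker] at hc ⊢
    exact (singularBoundary_push f n c).trans ((congrArg _ hc).trans (map_zero _))

lemma boundary_mem_ker (n : ℕ) (c : C(stdSimplex ℝ (Fin (n + 2)), X) →₀ ℤ) :
    singularBoundary X n c ∈ LinearMap.ker (singularDifferential X n) := by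
  cases n with
  | zero => exact LinearMap.mem_ker.2 rfl
  | succ n => exact singularBoundary_singularBoundary n c

lemma mem_ker_of_push {f : C(X, Y)} (hf : Function.Injective f) {n : ℕ}
    {c : C(stdSimplex ℝ (Fin (n + 1)), X) →₀ ℤ}
    (hc : singularPush f n c ∈ LinearMap.ker (singularDifferential Y n)) :
    c ∈ LinearMap.ker (singularDifferential X n) := by
  cases n with
  | zero => exact LinearMap.mem_ker.2 rfl
  | succ n =>
    refine LinearMap.mem_ker.2 (singularPush_injective hf n ?_)
    exact (singularBoundary_push f n c).symm.trans ((LinearMap.mem_ker.1 hc).trans (map_zero _).symm)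

lemma SHmap_class (d : ℕ) (f : C(X, Y)) {c : C(stdSimplex ℝ (Fin (d + 1)), X) →₀ ℤ}
    (hc : c ∈ LinearMap.ker (singularDifferential X d)) :
    SHmap d f (homologyClass X d ⟨c, hc⟩) =
      homologyClass Y d ⟨singularPush f d c, singularDifferential_push f hc⟩ :=
  SHmap_homologyClass d f _ _ rfl

lemma homologyClass_eq_iff (d : ℕ) (z w : LinearMap.ker (singularDifferential X d)) :
    homologyClass X d z = homologyClass X d w ↔ ∃ e, singularBoundary X d e = z.1 - w.1 := by
  rw [← sub_eq_zero, ← map_sub, homologyClass_eq_zero_iff]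
  rfl

/-- The inclusion of a subspace. -/
def subsetIncl (U : Set X) : C(U, X) := ⟨Subtype.val, continuous_subtype_val⟩

/-- The inclusion of a subspace into a larger one. -/
def subsetMap {U V : Set X} (h : U ⊆ V) : C(U, V) := ⟨Set.inclusion h, continuous_inclusion h⟩

lemma subsetIncl_injective (U : Set X) : Function.Injective (subsetIncl U) :=
  Subtype.val_injective

lemma subsetMap_injective {U V : Set X} (h : U ⊆ V) : Function.Injective (subsetMap h) :=
  Set.inclusion_injective h

lemma subsetIncl_comp_subsetMap {U V : Set X} (h : U ⊆ V) :
    (subsetIncl V).comp (subsetMap h) = subsetIncl U := rfl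

lemma range_singularPush_subsetIncl (U : Set X) (n : ℕ) :
    LinearMap.range (singularPush (subsetIncl U) n) =
      Finsupp.supported ℤ ℤ {σ : C(stdSimplex ℝ (Fin (n + 1)), X) | Set.range σ ⊆ U} := by
  have h : {σ : C(stdSimplex ℝ (Fin (n + 1)), X) | Set.range σ ⊆ U} =
      (subsetIncl U).comp '' Set.univ := by
    ext σ
    simp only [Set.mem_ofPred_eq, Set.image_univ, Set.mem_range]
    constructor
    · intro hσ
      exact ⟨⟨fun t => ⟨σ t, hσ ⟨t, rfl⟩⟩, by fun_prop⟩, rfl⟩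
    · rintro ⟨τ, rfl⟩ _ ⟨t, rfl⟩
      exact (τ t).2
  rw [h, ← Finsupp.lmapDomain_supported, Finsupp.supported_univ, Submodule.map_top]
  rfl

variable {U V : Set X}

lemma exists_push_add_push {n : ℕ} {c : C(stdSimplex ℝ (Fin (n + 1)), X) →₀ ℤ}
    (hc : c ∈ smallChains U V n) :
    ∃ u v, singularPush (subsetIncl U) n u + singularPush (subsetIncl V) n v = c := by
  have h : smallChains U V n =
      Finsupp.supported ℤ ℤ {σ : C(stdSimplex ℝ (Fin (n + 1)), X) | Set.range σ ⊆ U} ⊔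
      Finsupp.supported ℤ ℤ {σ : C(stdSimplex ℝ (Fin (n + 1)), X) | Set.range σ ⊆ V} := by
    rw [← Finsupp.supported_union]
    rfl
  rw [h, ← range_singularPush_subsetIncl, ← range_singularPush_subsetIncl, Submodule.mem_sup] at hc
  obtain ⟨_, ⟨u, rfl⟩, _, ⟨v, rfl⟩, h⟩ := hc
  exact ⟨u, v, h⟩

lemma push_mem_smallChains_left {n : ℕ} (u : C(stdSimplex ℝ (Fin (n + 1)), U) →₀ ℤ) :
    singularPush (subsetIncl U) n u ∈ smallChains U V n := by
  have h : singularPush (subsetIncl U) n u ∈ LinearMap.range (singularPush (subsetIncl U) n) :=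
    ⟨u, rfl⟩
  rw [range_singularPush_subsetIncl] at h
  exact Finsupp.supported_mono (fun σ hσ => Or.inl hσ) h

lemma push_mem_smallChains_right {n : ℕ} (v : C(stdSimplex ℝ (Fin (n + 1)), V) →₀ ℤ) :
    singularPush (subsetIncl V) n v ∈ smallChains U V n := by
  have h : singularPush (subsetIncl V) n v ∈ LinearMap.range (singularPush (subsetIncl V) n) :=
    ⟨v, rfl⟩
  rw [range_singularPush_subsetIncl] at h
  exact Finsupp.supported_mono (fun σ hσ => Or.inr hσ) h

lemma exists_push_eq_of_push_eq {n : ℕ} {u : C(stdSimplex ℝ (Fin (n + 1)), U) →₀ ℤ}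
    {v : C(stdSimplex ℝ (Fin (n + 1)), V) →₀ ℤ}
    (h : singularPush (subsetIncl U) n u = singularPush (subsetIncl V) n v) :
    ∃ w, singularPush (subsetMap (Set.inter_subset_left : U ∩ V ⊆ U)) n w = u ∧
      singularPush (subsetMap (Set.inter_subset_right : U ∩ V ⊆ V)) n w = v := by
  have h₁ : singularPush (subsetIncl U) n u ∈ LinearMap.range (singularPush (subsetIncl U) n) :=
    ⟨u, rfl⟩
  have h₂ : singularPush (subsetIncl U) n u ∈ LinearMap.range (singularPush (subsetIncl V) n) :=
    ⟨v, h.symm⟩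
  rw [range_singularPush_subsetIncl] at h₁ h₂
  have h₃ : singularPush (subsetIncl U) n u ∈
      LinearMap.range (singularPush (subsetIncl (U ∩ V)) n) := by
    rw [range_singularPush_subsetIncl, Finsupp.mem_supported]
    exact fun σ hσ => Set.subset_inter ((Finsupp.mem_supported _ _).1 h₁ hσ)
      ((Finsupp.mem_supported _ _).1 h₂ hσ)
  obtain ⟨w, hw⟩ := h₃
  refine ⟨w, singularPush_injective (subsetIncl_injective U) n ?_,
    singularPush_injective (subsetIncl_injective V) n ?_⟩
  · rw [singularPush_push, subsetIncl_comp_subsetMap, hw]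
  · rw [singularPush_push, subsetIncl_comp_subsetMap, hw, h]

lemma push_left_eq_push_right {n : ℕ}
    (w : C(stdSimplex ℝ (Fin (n + 1)), (U ∩ V : Set X)) →₀ ℤ) :
    singularPush (subsetIncl U) n
        (singularPush (subsetMap (Set.inter_subset_left : U ∩ V ⊆ U)) n w) =
      singularPush (subsetIncl V) n
        (singularPush (subsetMap (Set.inter_subset_right : U ∩ V ⊆ V)) n w) := by
  rw [singularPush_push, singularPush_push]
  rfl

/-- A small boundary bounds a small chain. -/
lemma exists_small_of_boundary (hU : IsOpen U) (hV : IsOpen V) (hUV : U ∪ V = Set.univ) {n : ℕ}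
    {u : C(stdSimplex ℝ (Fin (n + 1)), U) →₀ ℤ} {v : C(stdSimplex ℝ (Fin (n + 1)), V) →₀ ℤ}
    {e : C(stdSimplex ℝ (Fin (n + 2)), X) →₀ ℤ}
    (h : singularBoundary X n e =
      singularPush (subsetIncl U) n u + singularPush (subsetIncl V) n v) :
    ∃ u' v' w, singularPush (subsetMap (Set.inter_subset_left : U ∩ V ⊆ U)) n w =
        u - singularBoundary U n u' ∧
      singularPush (subsetMap (Set.inter_subset_right : U ∩ V ⊆ V)) n w =
        singularBoundary V n v' - v := by
  have hs : singularBoundary X n e ∈ smallChains U V n := by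
    rw [h]
    exact Submodule.add_mem _ (push_mem_smallChains_left u) (push_mem_smallChains_right v)
  obtain ⟨f, hf⟩ := exists_sub_boundary_mem_smallChains hU hV hUV e hs
  obtain ⟨u', v', h'⟩ := exists_push_add_push hf
  have h₁ := congrArg (singularBoundary X n) h'
  rw [map_add, map_sub, singularBoundary_singularBoundary, sub_zero, singularBoundary_push,
    singularBoundary_push, h] at h₁
  obtain ⟨w, hw⟩ := exists_push_eq_of_push_eq (U := U) (V := V) (n := n)
    (u := u - singularBoundary U n u') (v := singularBoundary V n v' - v) (by
      rw [map_sub, map_sub, sub_eq_sub_iff_add_eq_add]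
      rw [← h₁]
      exact add_comm _ _)
  exact ⟨u', v', w, hw⟩

lemma mayerVietoris_middle (hU : IsOpen U) (hV : IsOpen V) (hUV : U ∪ V = Set.univ) (d : ℕ)
    (a : SH d U) (b : SH d V) (h : SHmap d (subsetIncl U) a = SHmap d (subsetIncl V) b) :
    ∃ c : SH d (U ∩ V : Set X),
      SHmap d (subsetMap (Set.inter_subset_left : U ∩ V ⊆ U)) c = a ∧
      SHmap d (subsetMap (Set.inter_subset_right : U ∩ V ⊆ V)) c = b := by
  obtain ⟨⟨u, hu⟩, rfl⟩ := homologyClass_surjective d a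
  obtain ⟨⟨v, hv⟩, rfl⟩ := homologyClass_surjective d b
  rw [SHmap_class, SHmap_class, homologyClass_eq_iff] at h
  obtain ⟨e, he⟩ := h
  obtain ⟨u', v', w, h₁, h₂⟩ := exists_small_of_boundary (u := u) (v := -v) hU hV hUV
    (he.trans (by simp [sub_eq_add_neg]))
  have hw : w ∈ LinearMap.ker (singularDifferential (U ∩ V : Set X) d) := by
    refine mem_ker_of_push (subsetMap_injective Set.inter_subset_left) ?_
    rw [h₁]
    exact Submodule.sub_mem _ hu (boundary_mem_ker _ _)
  refine ⟨homologyClass _ d ⟨w, hw⟩, ?_, ?_⟩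
  · rw [SHmap_class, homologyClass_eq_iff]
    exact ⟨-u', by simp [h₁]⟩
  · rw [SHmap_class, homologyClass_eq_iff]
    exact ⟨v', by simp [h₂]⟩

lemma mayerVietoris_zero (hUV : U ∪ V = Set.univ) (x : SH 0 X) :
    ∃ (a : SH 0 U) (b : SH 0 V), SHmap 0 (subsetIncl U) a + SHmap 0 (subsetIncl V) b = x := by
  obtain ⟨⟨c, hc⟩, rfl⟩ := homologyClass_surjective 0 x
  obtain ⟨u, v, h⟩ := exists_push_add_push (mem_smallChains_zero hUV c)
  refine ⟨homologyClass U 0 ⟨u, LinearMap.mem_ker.2 rfl⟩,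
    homologyClass V 0 ⟨v, LinearMap.mem_ker.2 rfl⟩, ?_⟩
  rw [SHmap_class, SHmap_class, ← map_add]
  congr 1
  exact Subtype.ext h

/-- Pairs of chains with opposite boundaries, together with the chain of the intersection
that these boundaries come from. -/
noncomputable def connectingChains (U V : Set X) (d : ℕ) :
    Submodule ℤ ((C(stdSimplex ℝ (Fin (d + 2)), U) →₀ ℤ) ×
      (C(stdSimplex ℝ (Fin (d + 2)), V) →₀ ℤ) ×
      (C(stdSimplex ℝ (Fin (d + 1)), (U ∩ V : Set X)) →₀ ℤ)) where
  carrier := {t | singularBoundary U d t.1 =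
      singularPush (subsetMap (Set.inter_subset_left : U ∩ V ⊆ U)) d t.2.2 ∧
    singularBoundary V d t.2.1 =
      -singularPush (subsetMap (Set.inter_subset_right : U ∩ V ⊆ V)) d t.2.2}
  add_mem' := by
    rintro s t ⟨hs₁, hs₂⟩ ⟨ht₁, ht₂⟩
    refine ⟨?_, ?_⟩
    · simp only [Prod.fst_add, Prod.snd_add, map_add, hs₁, ht₁]
    · simp only [Prod.fst_add, Prod.snd_add, map_add, hs₂, ht₂, neg_add]
  zero_mem' := by simp
  smul_mem' := by
    rintro a t ⟨ht₁, ht₂⟩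
    refine ⟨?_, ?_⟩
    · simp only [Prod.smul_fst, Prod.smul_snd, map_smul, ht₁]
    · simp only [Prod.smul_fst, Prod.smul_snd, map_smul, ht₂, smul_neg]

lemma connectingChains_total_mem {d : ℕ} (t : connectingChains U V d) :
    singularPush (subsetIncl U) (d + 1) t.1.1 + singularPush (subsetIncl V) (d + 1) t.1.2.1 ∈
      LinearMap.ker (singularDifferential X (d + 1)) := by
  have h₁ : singularBoundary U d t.1.1 = _ := t.2.1
  have h₂ : singularBoundary V d t.1.2.1 = _ := t.2.2
  refine LinearMap.mem_ker.2 ?_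
  change singularBoundary X d _ = 0
  rw [map_add, singularBoundary_push, singularBoundary_push, h₁, h₂, map_neg,
    push_left_eq_push_right, add_neg_cancel]

lemma connectingChains_inter_mem {d : ℕ} (t : connectingChains U V d) :
    t.1.2.2 ∈ LinearMap.ker (singularDifferential (U ∩ V : Set X) d) := by
  obtain ⟨⟨u, v, w⟩, h₁, h₂⟩ := t
  refine mem_ker_of_push (subsetMap_injective Set.inter_subset_left) ?_
  rw [← h₁]
  exact boundary_mem_ker _ _

/-- The class of the sum of the two chains. -/
noncomputable def connectingTotal (U V : Set X) (d : ℕ) :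
    connectingChains U V d →+ SH (d + 1) X :=
  (homologyClass X (d + 1)).comp
    { toFun := fun t => ⟨_, connectingChains_total_mem t⟩
      map_zero' := by simp
      map_add' := fun s t => by
        apply Subtype.ext
        simp only [Submodule.coe_add, Prod.fst_add, Prod.snd_add, map_add]
        abel }

/-- The class of the chain in the intersection. -/
noncomputable def connectingInter (U V : Set X) (d : ℕ) :
    connectingChains U V d →+ SH d (U ∩ V : Set X) :=
  (homologyClass (U ∩ V : Set X) d).comp
    { toFun := fun t => ⟨_, connectingChains_inter_mem t⟩
      map_zero' := by simp
      map_add' := fun s t => rfl }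

lemma connectingTotal_surjective (hU : IsOpen U) (hV : IsOpen V) (hUV : U ∪ V = Set.univ) (d : ℕ) :
    Function.Surjective (connectingTotal U V d) := by
  intro x
  obtain ⟨⟨c, hc⟩, rfl⟩ := homologyClass_surjective (d + 1) x
  have hc' : singularBoundary X d c = 0 := hc
  obtain ⟨e, he⟩ := exists_sub_boundary_mem_smallChains hU hV hUV c
    (hc'.symm ▸ Submodule.zero_mem _)
  obtain ⟨u, v, h⟩ := exists_push_add_push he
  have h₁ := congrArg (singularBoundary X d) h
  rw [map_add, map_sub, singularBoundary_singularBoundary, sub_zero, hc', singularBoundary_push,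
    singularBoundary_push, add_eq_zero_iff_eq_neg, ← map_neg] at h₁
  obtain ⟨w, hw₁, hw₂⟩ := exists_push_eq_of_push_eq h₁
  refine ⟨⟨(u, v, w), hw₁.symm, by rw [hw₂, neg_neg]⟩, ?_⟩
  refine (homologyClass_eq_iff _ _ _).2 ⟨-e, ?_⟩
  change _ = (singularPush (subsetIncl U) (d + 1) u + singularPush (subsetIncl V) (d + 1) v) - c
  rw [h, map_neg]
  abel

lemma connectingInter_eq_zero (hU : IsOpen U) (hV : IsOpen V) (hUV : U ∪ V = Set.univ) {d : ℕ}
    {t : connectingChains U V d} (ht : connectingTotal U V d t = 0) :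
    connectingInter U V d t = 0 := by
  obtain ⟨⟨u, v, w⟩, h₁, h₂⟩ := t
  obtain ⟨e, he⟩ := (homologyClass_eq_zero_iff _ _).1 ht
  obtain ⟨u', v', w', hw₁, hw₂⟩ := exists_small_of_boundary hU hV hUV he
  refine (homologyClass_eq_zero_iff _ _).2 ⟨w', ?_⟩
  apply singularPush_injective (subsetMap_injective (Set.inter_subset_left : U ∩ V ⊆ U)) d
  rw [← singularBoundary_push, hw₁, map_sub, singularBoundary_singularBoundary, sub_zero]
  exact h₁

lemma exists_of_connectingInter_eq_zero {d : ℕ} {t : connectingChains U V d}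
    (ht : connectingInter U V d t = 0) :
    ∃ (a : SH (d + 1) U) (b : SH (d + 1) V),
      SHmap (d + 1) (subsetIncl U) a + SHmap (d + 1) (subsetIncl V) b =
        connectingTotal U V d t := by
  have h₁ : singularBoundary U d t.1.1 = _ := t.2.1
  have h₂ : singularBoundary V d t.1.2.1 = _ := t.2.2
  obtain ⟨w', hw'⟩ := (homologyClass_eq_zero_iff _ _).1 ht
  have hw'' : singularBoundary (U ∩ V : Set X) d w' = t.1.2.2 := hw'
  refine ⟨homologyClass _ _ ⟨t.1.1 - singularPush (subsetMap Set.inter_subset_left) (d + 1) w', ?_⟩,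
    homologyClass _ _ ⟨t.1.2.1 + singularPush (subsetMap Set.inter_subset_right) (d + 1) w', ?_⟩,
    ?_⟩
  · refine LinearMap.mem_ker.2 ?_
    change singularBoundary U d _ = 0
    rw [map_sub, singularBoundary_push, hw'', h₁, sub_self]
  · refine LinearMap.mem_ker.2 ?_
    change singularBoundary V d _ = 0
    rw [map_add, singularBoundary_push, hw'', h₂, neg_add_cancel]
  · rw [SHmap_class, SHmap_class, ← map_add]
    refine congrArg (homologyClass X (d + 1)) (Subtype.ext ?_)
    change singularPush _ _ _ + singularPush _ _ _ =
      singularPush _ _ t.1.1 + singularPush _ _ t.1.2.1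
    rw [map_sub, map_add, push_left_eq_push_right]
    abel

lemma connectingTotal_apply {d : ℕ} (t : connectingChains U V d) :
    connectingTotal U V d t = homologyClass X (d + 1) ⟨_, connectingChains_total_mem t⟩ :=
  rfl

lemma homologyClass_add {d : ℕ} (x y z : LinearMap.ker (singularDifferential X d))
    (h : z = x + y) :
    homologyClass X d x + homologyClass X d y = homologyClass X d z := by
  rw [h, map_add]

lemma exists_connectingTotal_eq {d : ℕ} (a : SH (d + 1) U) (b : SH (d + 1) V) :
    ∃ t : connectingChains U V d, connectingInter U V d t = 0 ∧ connectingTotal U V d t =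
      SHmap (d + 1) (subsetIncl U) a + SHmap (d + 1) (subsetIncl V) b := by
  obtain ⟨⟨u, hu⟩, rfl⟩ := homologyClass_surjective _ a
  obtain ⟨⟨v, hv⟩, rfl⟩ := homologyClass_surjective _ b
  have hu' : singularBoundary U d u = 0 := hu
  have hv' : singularBoundary V d v = 0 := hv
  have ht : (u, v, 0) ∈ connectingChains U V d :=
    ⟨hu'.trans (map_zero _).symm, hv'.trans (by rw [map_zero, neg_zero])⟩
  refine ⟨⟨(u, v, 0), ht⟩, ?_, ?_⟩
  · exact (homologyClass_eq_zero_iff _ _).2 ⟨0, map_zero _⟩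
  · rw [SHmap_class, SHmap_class, connectingTotal_apply]
    symm
    apply homologyClass_add
    apply Subtype.ext
    rfl

lemma connectingInter_mem_ker {d : ℕ} (t : connectingChains U V d) :
    SHmap d (subsetMap (Set.inter_subset_left : U ∩ V ⊆ U)) (connectingInter U V d t) = 0 ∧
      SHmap d (subsetMap (Set.inter_subset_right : U ∩ V ⊆ V)) (connectingInter U V d t) = 0 := by
  have h₁ : singularBoundary U d t.1.1 = _ := t.2.1
  have h₂ : singularBoundary V d t.1.2.1 = _ := t.2.2
  have hw : connectingInter U V d t = homologyClass _ d ⟨t.1.2.2, connectingChains_inter_mem t⟩ :=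
    rfl
  rw [hw, SHmap_class, SHmap_class, homologyClass_eq_zero_iff, homologyClass_eq_zero_iff]
  refine ⟨⟨t.1.1, h₁⟩, ⟨-t.1.2.1, ?_⟩⟩
  rw [map_neg, h₂, neg_neg]

lemma exists_connectingInter_eq {d : ℕ} {y : SH d (U ∩ V : Set X)}
    (hy₁ : SHmap d (subsetMap (Set.inter_subset_left : U ∩ V ⊆ U)) y = 0)
    (hy₂ : SHmap d (subsetMap (Set.inter_subset_right : U ∩ V ⊆ V)) y = 0) :
    ∃ t, connectingInter U V d t = y := by
  obtain ⟨⟨w, hw⟩, rfl⟩ := homologyClass_surjective _ y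
  rw [SHmap_class, homologyClass_eq_zero_iff] at hy₁ hy₂
  obtain ⟨u, hu⟩ := hy₁
  obtain ⟨v, hv⟩ := hy₂
  exact ⟨⟨(u, -v, w), hu, by rw [map_neg, hv]⟩, rfl⟩

/-- The connecting homomorphism of the Mayer–Vietoris sequence. -/
lemma mayerVietoris_connecting (hU : IsOpen U) (hV : IsOpen V) (hUV : U ∪ V = Set.univ) (d : ℕ) :
    ∃ δ : SH (d + 1) X →ₗ[ℤ] SH d (U ∩ V : Set X),
      (∀ x, δ x = 0 ↔ ∃ (a : SH (d + 1) U) (b : SH (d + 1) V),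
        SHmap (d + 1) (subsetIncl U) a + SHmap (d + 1) (subsetIncl V) b = x) ∧
      (∀ y, y ∈ LinearMap.range δ ↔
        SHmap d (subsetMap (Set.inter_subset_left : U ∩ V ⊆ U)) y = 0 ∧
        SHmap d (subsetMap (Set.inter_subset_right : U ∩ V ⊆ V)) y = 0) := by
  have hs := connectingTotal_surjective hU hV hUV d
  obtain ⟨δ, hδ⟩ : ∃ δ : SH (d + 1) X →+ SH d (U ∩ V : Set X),
      ∀ t, δ (connectingTotal U V d t) = connectingInter U V d t :=
    ⟨(connectingTotal U V d).liftOfSurjective hs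
      ⟨connectingInter U V d, fun t ht => connectingInter_eq_zero hU hV hUV ht⟩,
      fun t => AddMonoidHom.liftOfRightInverse_comp_apply _ _ _ _ t⟩
  let δ' : SH (d + 1) X →ₗ[ℤ] SH d (U ∩ V : Set X) :=
    { δ with map_smul' := fun n x => by simpa using map_intCast_smul δ ℤ ℤ n x }
  have hδ' : ∀ x, δ' x = δ x := fun x => rfl
  refine ⟨δ', fun x => ⟨fun hx => ?_, ?_⟩, fun y => ⟨?_, ?_⟩⟩
  · obtain ⟨t, rfl⟩ := hs x
    exact exists_of_connectingInter_eq_zero ((hδ t).symm.trans hx)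
  · rintro ⟨a, b, rfl⟩
    obtain ⟨t, ht, h⟩ := exists_connectingTotal_eq a b
    rw [hδ', ← h, hδ, ht]
  · rintro ⟨x, rfl⟩
    obtain ⟨t, rfl⟩ := hs x
    rw [hδ', hδ]
    exact connectingInter_mem_ker t
  · rintro ⟨h₁, h₂⟩
    obtain ⟨t, rfl⟩ := exists_connectingInter_eq h₁ h₂
    exact ⟨_, hδ t⟩

end MayerVietoris

section Rank

/-- `M` is free of finite rank `k`. -/
def HasRank (R M : Type) [CommRing R] [AddCommGroup M] [Module R M] (k : ℕ) : Prop :=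
  Module.Free R M ∧ Module.Finite R M ∧ Module.finrank R M = k

variable {R M N : Type} [CommRing R] [AddCommGroup M] [Module R M] [AddCommGroup N]
  [Module R N]

lemma HasRank.of_equiv {k : ℕ} (h : HasRank R M k) (e : M ≃ₗ[R] N) : HasRank R N k := by
  obtain ⟨h₁, h₂, h₃⟩ := h
  exact ⟨Module.Free.of_equiv e, Module.Finite.equiv e, e.finrank_eq.symm.trans h₃⟩

lemma HasRank.of_bijective {k : ℕ} (h : HasRank R M k) (f : M →ₗ[R] N)
    (hf : Function.Bijective f) : HasRank R N k :=
  h.of_equiv (LinearEquiv.ofBijective f hf)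

lemma hasRank_zero [Nontrivial R] [Subsingleton M] : HasRank R M 0 :=
  ⟨inferInstance, inferInstance, Module.finrank_zero_of_subsingleton⟩

lemma hasRank_submodule_zero [Nontrivial R] {P : Submodule R M} (h : ∀ x ∈ P, x = 0) :
    HasRank R P 0 := by
  have : Subsingleton P := ⟨fun x y => Subtype.ext (by rw [h x x.2, h y y.2])⟩
  exact hasRank_zero

lemma HasRank.subsingleton [IsDomain R] (h : HasRank R M 0) : Subsingleton M := by
  obtain ⟨h₁, h₂, h₃⟩ := h
  exact Module.finrank_zero_iff.1 h₃

/-- An extension of free modules of finite rank is such, and ranks add up. -/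
lemma HasRank.of_ker [Nontrivial R] {k l : ℕ} (f : M →ₗ[R] N) (hf : Function.Surjective f)
    (hk : HasRank R (LinearMap.ker f) k) (hl : HasRank R N l) : HasRank R M (l + k) := by
  obtain ⟨h₁, h₂, h₃⟩ := hk
  obtain ⟨h₄, h₅, h₆⟩ := hl
  obtain ⟨s, hs⟩ := Module.projective_lifting_property f LinearMap.id hf
  have hs' : ∀ y, f (s y) = y := fun y => congrArg (fun φ => φ y) hs
  let g : N × LinearMap.ker f →ₗ[R] M := s.coprod (LinearMap.ker f).subtype
  have hg : ∀ y z, g (y, z) = s y + z := fun y z => by simp [g]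
  have hl : HasRank R (N × LinearMap.ker f) (l + k) :=
    ⟨inferInstance, inferInstance, by rw [Module.finrank_prod, h₃, h₆]⟩
  refine hl.of_bijective g ⟨?_, fun x => ?_⟩
  · rw [injective_iff_map_eq_zero]
    rintro ⟨y, z⟩ h
    have h' := congrArg f h
    rw [hg] at h
    rw [hg, map_add, hs', z.2, add_zero, map_zero] at h'
    subst h'
    rw [map_zero, zero_add] at h
    exact Prod.ext rfl (Subtype.ext h)
  · have hx : x - s (f x) ∈ LinearMap.ker f := by
      rw [LinearMap.mem_ker, map_sub, hs', sub_self]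
    exact ⟨(f x, ⟨_, hx⟩), by rw [hg]; exact add_sub_cancel _ _⟩

/-- A linear map which is injective on a submodule transports its rank to the image. -/
lemma HasRank.of_image {k : ℕ} {P : Submodule R M} {Q : Submodule R N} (h : HasRank R Q k)
    (f : M →ₗ[R] N) (hP : ∀ x ∈ P, f x ∈ Q) (hi : ∀ x ∈ P, f x = 0 → x = 0)
    (hs : ∀ y ∈ Q, ∃ x ∈ P, f x = y) : HasRank R P k := by
  refine h.of_equiv (LinearEquiv.ofBijective (f.restrict hP) ⟨?_, ?_⟩).symm
  · rw [injective_iff_map_eq_zero]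
    exact fun x hx => Subtype.ext (hi x x.2 (congrArg Subtype.val hx))
  · rintro ⟨y, hy⟩
    obtain ⟨x, hx, rfl⟩ := hs y hy
    exact ⟨⟨x, hx⟩, rfl⟩

lemma HasRank.submodule {k : ℕ} {P : Submodule R N} (h : HasRank R M k) (f : M →ₗ[R] N)
    (hP : ∀ x, f x ∈ P) (hi : ∀ x, f x = 0 → x = 0) (hs : ∀ y ∈ P, ∃ x, f x = y) :
    HasRank R P k := by
  refine h.of_bijective (f.codRestrict P hP) ⟨?_, ?_⟩
  · rw [injective_iff_map_eq_zero]
    exact fun x hx => hi x (congrArg Subtype.val hx)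
  · rintro ⟨y, hy⟩
    obtain ⟨x, rfl⟩ := hs y hy
    exact ⟨x, rfl⟩

end Rank

section Betti

variable {X Y Z B S : Type} [TopologicalSpace X] [TopologicalSpace Y] [TopologicalSpace Z]
  [TopologicalSpace B] [TopologicalSpace S]

/-- All homology groups of `X` are free, of ranks given by `b`. -/
def HasBetti (X : Type) [TopologicalSpace X] (b : ℕ → ℕ) : Prop :=
  ∀ d, HasRank ℤ (SH d X) (b d)

/-- The map `p` is onto in homology, with free kernels of ranks given by `k`. -/
def HasKerBetti (p : C(X, B)) (k : ℕ → ℕ) : Prop :=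
  ∀ d, Function.Surjective (SHmap d p) ∧ @HasRank ℤ (LinearMap.ker (SHmap d p)) _ _ (Submodule.module _) (k d)

/-- The map `f` is an isomorphism in homology. -/
def IsHomologyIso (f : C(X, Y)) : Prop :=
  ∀ d, Function.Bijective (SHmap d f)

lemma SHmap_SHmap (d : ℕ) (g : C(Y, Z)) (f : C(X, Y)) (x : SH d X) :
    SHmap d g (SHmap d f x) = SHmap d (g.comp f) x := by
  rw [SHmap_comp]; rfl

lemma isHomologyIso_of_homotopic {f : C(X, Y)} {g : C(Y, X)}
    (h₁ : (g.comp f).Homotopic (ContinuousMap.id X))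
    (h₂ : (f.comp g).Homotopic (ContinuousMap.id Y)) : IsHomologyIso f := by
  intro d
  refine Function.bijective_iff_has_inverse.2 ⟨SHmap d g, fun x => ?_, fun y => ?_⟩
  · rw [SHmap_SHmap, SHmap_eq_of_homotopic d h₁, SHmap_id]; rfl
  · rw [SHmap_SHmap, SHmap_eq_of_homotopic d h₂, SHmap_id]; rfl

lemma isHomologyIso_of_homeomorph (e : X ≃ₜ Y) : IsHomologyIso (e : C(X, Y)) :=
  isHomologyIso_of_homotopic (g := (e.symm : C(Y, X)))
    (by rw [Homeomorph.symm_comp_toContinuousMap]) (by rw [Homeomorph.toContinuousMap_comp_symm])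

lemma HasBetti.of_iso {b : ℕ → ℕ} (h : HasBetti X b) {f : C(X, Y)} (hf : IsHomologyIso f) :
    HasBetti Y b :=
  fun d => (h d).of_bijective _ (hf d)

lemma HasBetti.of_homeomorph {b : ℕ → ℕ} (h : HasBetti X b) (e : X ≃ₜ Y) : HasBetti Y b :=
  h.of_iso (isHomologyIso_of_homeomorph e)

lemma HasKerBetti.hasBetti {b k : ℕ → ℕ} {p : C(X, B)} (h : HasKerBetti p k)
    (hB : HasBetti B b) : HasBetti X fun d => b d + k d :=
  fun d => HasRank.of_ker _ (h d).1 (h d).2 (hB d)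

lemma HasKerBetti.comp_iso {k : ℕ → ℕ} {p : C(Y, B)} (h : HasKerBetti p k) {f : C(X, Y)}
    (hf : IsHomologyIso f) : HasKerBetti (p.comp f) k := by
  refine fun d => ⟨?_, ?_⟩
  · rw [SHmap_comp]
    exact (h d).1.comp (hf d).2
  · refine (h d).2.of_image (SHmap d f) (fun x hx => ?_) (fun x _ hx => ?_) fun y hy => ?_
    · rw [LinearMap.mem_ker, SHmap_SHmap]; exact hx
    · exact (hf d).1 (hx.trans (map_zero _).symm)
    · obtain ⟨x, rfl⟩ := (hf d).2 y
      exact ⟨x, by rw [LinearMap.mem_ker, ← SHmap_SHmap]; exact hy, rfl⟩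

variable {U V : Set X}

lemma SHmap_incl_left (d : ℕ) (c : SH d (U ∩ V : Set X)) :
    SHmap d (subsetIncl U) (SHmap d (subsetMap Set.inter_subset_left) c) =
      SHmap d (subsetIncl V) (SHmap d (subsetMap Set.inter_subset_right) c) := by
  rw [SHmap_SHmap, SHmap_SHmap]
  rfl

/-- A degree-shifting computation for a map which is an isomorphism over two pieces. -/
lemma HasKerBetti.suspension {k : ℕ → ℕ} (hU : IsOpen U) (hV : IsOpen V)
    (hUV : U ∪ V = Set.univ) (p : C(X, B)) (pU : IsHomologyIso (p.comp (subsetIncl U)))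
    (pV : IsHomologyIso (p.comp (subsetIncl V)))
    (h : HasKerBetti (p.comp (subsetIncl (U ∩ V))) k) :
    HasKerBetti p fun d => if d = 0 then 0 else k (d - 1) := by
  have hp : ∀ d, Function.Surjective (SHmap d p) := fun d y => by
    obtain ⟨x, hx⟩ := (pU d).2 y
    exact ⟨_, (SHmap_SHmap d p _ x).trans hx⟩
  have hpl : ∀ d (c : SH d (U ∩ V : Set X)), SHmap d (p.comp (subsetIncl U))
      (SHmap d (subsetMap Set.inter_subset_left) c) = SHmap d (p.comp (subsetIncl (U ∩ V))) c :=
    fun d c => by rw [SHmap_SHmap]; rfl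
  have hpr : ∀ d (c : SH d (U ∩ V : Set X)), SHmap d (p.comp (subsetIncl V))
      (SHmap d (subsetMap Set.inter_subset_right) c) = SHmap d (p.comp (subsetIncl (U ∩ V))) c :=
    fun d c => by rw [SHmap_SHmap]; rfl
  have key : ∀ d (a : SH d U) (b : SH d V),
      SHmap d p (SHmap d (subsetIncl U) a + SHmap d (subsetIncl V) b) = 0 →
      SHmap d (subsetIncl U) a + SHmap d (subsetIncl V) b = 0 := by
    intro d a b hab
    obtain ⟨c, hc⟩ := (h d).1 (SHmap d (p.comp (subsetIncl U)) a)
    rw [map_add, SHmap_SHmap, SHmap_SHmap] at hab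
    have ha : SHmap d (subsetMap Set.inter_subset_left) c = a :=
      (pU d).1 ((hpl d c).trans hc)
    have hb : SHmap d (subsetMap Set.inter_subset_right) c = -b := by
      refine (pV d).1 ((hpr d c).trans (hc.trans ?_))
      rw [map_neg]
      exact eq_neg_of_add_eq_zero_left hab
    rw [← ha, SHmap_incl_left, hb, map_neg, neg_add_cancel]
  rintro (_ | d)
  · refine ⟨hp 0, ?_⟩
    refine hasRank_submodule_zero fun z hz => ?_
    obtain ⟨a, b, rfl⟩ := mayerVietoris_zero hUV z
    exact key 0 a b hz
  · refine ⟨hp (d + 1), ?_⟩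
    obtain ⟨δ, hδ₁, hδ₂⟩ := mayerVietoris_connecting hU hV hUV d
    refine (h d).2.of_image δ (fun x hx => ?_) (fun x hx hx' => ?_) (fun y hy => ?_)
    · have := ((hδ₂ (δ x)).1 ⟨x, rfl⟩).1
      rw [LinearMap.mem_ker, ← hpl, this, map_zero]
    · obtain ⟨a, b, rfl⟩ := (hδ₁ x).1 hx'
      exact key _ a b hx
    · obtain ⟨x, rfl⟩ : y ∈ LinearMap.range δ := by
        refine (hδ₂ y).2 ⟨(pU d).1 ?_, (pV d).1 ?_⟩
        · rw [hpl, map_zero]; exact hy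
        · rw [hpr, map_zero]; exact hy
      obtain ⟨a, ha⟩ := (pU (d + 1)).2 (SHmap (d + 1) p x)
      refine ⟨x - SHmap (d + 1) (subsetIncl U) a, ?_, ?_⟩
      · rw [LinearMap.mem_ker, map_sub, SHmap_SHmap, ha, sub_self]
      · rw [map_sub, (hδ₁ (SHmap (d + 1) (subsetIncl U) a)).2 ⟨a, 0, by rw [map_zero, add_zero]⟩,
          sub_zero]

/-- The homology of the complement of a section, in terms of that of a tubular neighbourhood. -/
lemma hasKerBetti_subsetIncl {k : ℕ → ℕ} (hU : IsOpen U) (hV : IsOpen V)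
    (hUV : U ∪ V = Set.univ) (pV : C(V, B)) (hpV : IsHomologyIso pV) (q : C(U, S))
    (hq : IsHomologyIso (q.comp (subsetMap (Set.inter_subset_left : U ∩ V ⊆ U))))
    (π : C(S, B)) (hπ : HasKerBetti π k)
    (hc : π.comp (q.comp (subsetMap (Set.inter_subset_left : U ∩ V ⊆ U))) =
      pV.comp (subsetMap Set.inter_subset_right)) :
    HasKerBetti (subsetIncl U) k := by
  have hq' : ∀ d c, SHmap d q (SHmap d (subsetMap Set.inter_subset_left) c) =
      SHmap d (q.comp (subsetMap (Set.inter_subset_left : U ∩ V ⊆ U))) c :=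
    fun d c => SHmap_SHmap d _ _ c
  have hj : ∀ d c, SHmap d pV (SHmap d (subsetMap Set.inter_subset_right) c) =
      SHmap d π (SHmap d (q.comp (subsetMap (Set.inter_subset_left : U ∩ V ⊆ U))) c) :=
    fun d c => by rw [SHmap_SHmap, SHmap_SHmap, hc]
  have hj0 : ∀ d c, SHmap d (subsetMap (Set.inter_subset_right : U ∩ V ⊆ V)) c = 0 ↔
      SHmap d π (SHmap d (q.comp (subsetMap (Set.inter_subset_left : U ∩ V ⊆ U))) c) = 0 :=
    fun d c => by rw [← hj, map_eq_zero_iff _ (hpV d).1]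
  have hi : ∀ d c, SHmap d (subsetMap (Set.inter_subset_left : U ∩ V ⊆ U)) c = 0 → c = 0 :=
    fun d c h => (hq d).1 (by rw [← hq', h, map_zero, map_zero])
  have hsj : ∀ d, Function.Surjective
      (SHmap d (subsetMap (Set.inter_subset_right : U ∩ V ⊆ V))) := fun d b => by
    obtain ⟨s, hs⟩ := (hπ d).1 (SHmap d pV b)
    obtain ⟨c, rfl⟩ := (hq d).2 s
    exact ⟨c, (hpV d).1 ((hj d c).trans hs)⟩
  have hsurj : ∀ d x, ∃ (a : SH d U) (b : SH d V),
      SHmap d (subsetIncl U) a + SHmap d (subsetIncl V) b = x := by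
    rintro (_ | d) x
    · exact mayerVietoris_zero hUV x
    · obtain ⟨δ, hδ₁, hδ₂⟩ := mayerVietoris_connecting hU hV hUV d
      exact (hδ₁ x).1 (hi d _ ((hδ₂ (δ x)).1 ⟨x, rfl⟩).1)
  have hker : ∀ d, ∀ a ∈ LinearMap.ker (SHmap d (subsetIncl U)),
      ∃ c, SHmap d (subsetMap (Set.inter_subset_left : U ∩ V ⊆ U)) c = a ∧
        SHmap d (subsetMap (Set.inter_subset_right : U ∩ V ⊆ V)) c = 0 := fun d a ha =>
    mayerVietoris_middle hU hV hUV d a 0 ((LinearMap.mem_ker.1 ha).trans (map_zero _).symm)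
  refine fun d => ⟨fun x => ?_, ?_⟩
  · obtain ⟨a, b, rfl⟩ := hsurj d x
    obtain ⟨c, rfl⟩ := hsj d b
    exact ⟨a + SHmap d (subsetMap Set.inter_subset_left) c, by rw [map_add, SHmap_incl_left]⟩
  · refine (hπ d).2.of_image (SHmap d q) (fun a ha => ?_) (fun a ha h => ?_) fun s hs => ?_
    · obtain ⟨c, rfl, hc0⟩ := hker d a ha
      rw [LinearMap.mem_ker, hq', ← hj0, hc0]
    · obtain ⟨c, rfl, -⟩ := hker d a ha
      rw [hq'] at h
      rw [(hq d).1 (h.trans (map_zero _).symm), map_zero]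
    · obtain ⟨c, rfl⟩ := (hq d).2 s
      refine ⟨SHmap d (subsetMap Set.inter_subset_left) c, ?_, hq' d c⟩
      rw [LinearMap.mem_ker, SHmap_incl_left, (hj0 d c).2 hs, map_zero]

end Betti

section Point

variable {X : Type} [TopologicalSpace X]

lemma hasBetti_of_isEmpty [IsEmpty X] : HasBetti X 0 := by
  intro d
  have : IsEmpty C(stdSimplex ℝ (Fin (d + 1)), X) :=
    ⟨fun σ => isEmptyElim (σ (Classical.arbitrary _))⟩
  have : Subsingleton (SH d X) := by
    refine ⟨fun x y => ?_⟩
    obtain ⟨x, rfl⟩ := homologyClass_surjective d x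
    obtain ⟨y, rfl⟩ := homologyClass_surjective d y
    rw [Subsingleton.elim x y]
  exact hasRank_zero

lemma singularBoundary_of_unique [Unique X] (n : ℕ)
    (σ : C(stdSimplex ℝ (Fin (n + 2)), X)) (τ : C(stdSimplex ℝ (Fin (n + 1)), X)) (a : ℤ) :
    singularBoundary X n (Finsupp.single σ a) = if Even n then 0 else Finsupp.single τ a := by
  have h : ∀ i, singularFace i σ = τ := fun i => Subsingleton.elim _ _
  rw [singularBoundary_single]
  simp only [h]
  rw [← Finset.sum_smul, Fin.sum_neg_one_pow]
  by_cases hn : Even n <;> simp [hn, Nat.even_add]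

lemma eq_single_of_unique [Unique X] {n : ℕ} (τ : C(stdSimplex ℝ (Fin (n + 1)), X))
    (c : C(stdSimplex ℝ (Fin (n + 1)), X) →₀ ℤ) : c = Finsupp.single τ (c τ) := by
  ext σ
  rw [Subsingleton.elim σ τ, Finsupp.single_eq_same]

lemma hasBetti_of_unique [Unique X] : HasBetti X fun d => if d = 0 then 1 else 0 := by
  rintro (_ | d)
  · let σ : C(stdSimplex ℝ (Fin (0 + 1)), X) := ContinuousMap.const _ default
    have hc : ∀ n, Finsupp.single σ n ∈ LinearMap.ker (singularDifferential X 0) := fun n =>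
      LinearMap.mem_ker.2 rfl
    have h1 : HasRank ℤ ℤ 1 := ⟨inferInstance, inferInstance, Module.finrank_self ℤ⟩
    let φ : ℤ →+ SH 0 X := (homologyClass X 0).comp
      { toFun := fun n => ⟨Finsupp.single σ n, hc n⟩
        map_zero' := Subtype.ext (Finsupp.single_zero σ)
        map_add' := fun m n => Subtype.ext (Finsupp.single_add σ m n) }
    have hφ : ∀ n, φ n = homologyClass X 0 ⟨Finsupp.single σ n, hc n⟩ := fun n => rfl
    refine h1.of_bijective
      { φ with map_smul' := fun n x => by simpa using map_intCast_smul φ ℤ ℤ n x } ⟨?_, fun x => ?_⟩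
    · rw [injective_iff_map_eq_zero]
      intro n hn
      obtain ⟨e, he⟩ := (homologyClass_eq_zero_iff _ _).1 ((hφ n).symm.trans hn)
      rw [eq_single_of_unique (ContinuousMap.const _ default) e,
        singularBoundary_of_unique _ _ σ, if_pos Even.zero] at he
      exact ((Finsupp.single_eq_zero).1 he.symm)
    · obtain ⟨⟨c, h⟩, rfl⟩ := homologyClass_surjective 0 x
      refine ⟨c σ, (hφ (c σ)).trans (congrArg (homologyClass X 0) (Subtype.ext ?_))⟩
      exact (eq_single_of_unique σ c).symm
  · have : Subsingleton (SH (d + 1) X) := by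
      suffices h : ∀ x : SH (d + 1) X, x = 0 from ⟨fun x y => by rw [h x, h y]⟩
      intro x
      obtain ⟨⟨c, hc⟩, rfl⟩ := homologyClass_surjective _ x
      have hc' : singularBoundary X d c = 0 := hc
      refine (homologyClass_eq_zero_iff _ _).2 ?_
      let σ : C(stdSimplex ℝ (Fin (d + 1 + 1)), X) := ContinuousMap.const _ default
      rw [eq_single_of_unique σ c, singularBoundary_of_unique _ _ (ContinuousMap.const _ default)]
        at hc'
      by_cases hd : Even d
      · refine ⟨Finsupp.single (ContinuousMap.const _ default) (c σ), ?_⟩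
        rw [singularBoundary_of_unique _ _ σ, if_neg (by simpa [Nat.even_add_one] using hd)]
        exact (eq_single_of_unique σ c).symm
      · rw [if_neg hd, Finsupp.single_eq_zero] at hc'
        refine ⟨0, ?_⟩
        rw [map_zero]
        exact ((eq_single_of_unique σ c).trans (by rw [hc', Finsupp.single_zero])).symm
    exact hasRank_zero

end Point

section Segment

variable {B E Y Z : Type} [TopologicalSpace B] [NormedAddCommGroup E] [NormedSpace ℝ E]
  [TopologicalSpace Y] [TopologicalSpace Z]

/-- Two maps are homotopic if they are joined by fibrewise segments. -/
lemma homotopic_of_segment {e : Y → B × E} (he : Topology.IsEmbedding e) (f g : C(Z, Y))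
    (h₁ : ∀ z, (e (f z)).1 = (e (g z)).1)
    (h₂ : ∀ z, ∀ t ∈ Set.Icc (0 : ℝ) 1, ((e (f z)).1, (1 - t) • (e (f z)).2 + t • (e (g z)).2) ∈
      Set.range e) : f.Homotopic g := by
  choose φ hφ using h₂
  refine ⟨⟨⟨fun p => φ p.2 p.1 p.1.2, ?_⟩, fun z => ?_, fun z => ?_⟩⟩
  · rw [he.isInducing.continuous_iff]
    have h : e ∘ (fun p : unitInterval × Z => φ p.2 p.1 p.1.2) = fun p : unitInterval × Z =>
        ((e (f p.2)).1, (1 - (p.1 : ℝ)) • (e (f p.2)).2 + (p.1 : ℝ) • (e (g p.2)).2) := by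
      ext1 p
      exact hφ _ _ _
    rw [h]
    have := he.continuous
    fun_prop
  · refine he.injective ((hφ _ _ _).trans ?_)
    simp
  · refine he.injective ((hφ _ _ _).trans ?_)
    refine Prod.ext (h₁ z) ?_
    simp

end Segment

section Punctured

variable {B E F : Type} [TopologicalSpace B] [NormedAddCommGroup E] [NormedSpace ℝ E]
  [NormedAddCommGroup F] [NormedSpace ℝ F]

/-- The product of `B` and the punctured space `E`. -/
abbrev Punctured (B E : Type) [NormedAddCommGroup E] : Type :=
  {p : B × E // p.2 ≠ 0}

/-- The projection to the first factor. -/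
def puncturedProj (B E : Type) [TopologicalSpace B] [NormedAddCommGroup E] :
    C(Punctured B E, B) :=
  ⟨fun p => p.1.1, by fun_prop⟩

lemma isEmbedding_subset_subtype {X : Type} [TopologicalSpace X] {C : X → Prop}
    (U : Set {x // C x}) : Topology.IsEmbedding fun u : U => u.1.1 :=
  Topology.IsEmbedding.subtypeVal.comp Topology.IsEmbedding.subtypeVal

lemma hasKerBetti_punctured_real {b : ℕ → ℕ} (hB : HasBetti B b) :
    HasKerBetti (puncturedProj B ℝ) b := by
  let U : Set (Punctured B ℝ) := {p | 0 < p.1.2}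
  let V : Set (Punctured B ℝ) := {p | p.1.2 < 0}
  have hU : IsOpen U := isOpen_lt (by fun_prop) (by fun_prop)
  have hV : IsOpen V := isOpen_lt (by fun_prop) (by fun_prop)
  have hUV : U ∪ V = Set.univ := Set.eq_univ_of_forall fun p => (lt_or_gt_of_ne p.2).symm
  have hE : IsEmpty (U ∩ V : Set (Punctured B ℝ)) := ⟨fun p =>
    lt_asymm (show 0 < p.1.1.2 from p.2.1) (show p.1.1.2 < 0 from p.2.2)⟩
  have h0 : ∀ d, Subsingleton (SH d (U ∩ V : Set (Punctured B ℝ))) := fun d =>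
    (hasBetti_of_isEmpty d).subsingleton
  let p := puncturedProj B ℝ
  let sU : C(B, U) := ⟨fun x => ⟨⟨(x, 1), one_ne_zero⟩, zero_lt_one (α := ℝ)⟩, by fun_prop⟩
  let sV : C(B, V) :=
    ⟨fun x => ⟨⟨(x, -1), by norm_num⟩, neg_one_lt_zero (R := ℝ)⟩, by fun_prop⟩
  have psU : ∀ d x, SHmap d p (SHmap d (subsetIncl U) (SHmap d sU x)) = x := fun d x => by
    rw [SHmap_SHmap, SHmap_SHmap]
    exact congrArg (fun φ => φ x) (SHmap_id d)
  have psV : ∀ d x, SHmap d p (SHmap d (subsetIncl V) (SHmap d sV x)) = x := fun d x => by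
    rw [SHmap_SHmap, SHmap_SHmap]
    exact congrArg (fun φ => φ x) (SHmap_id d)
  have sUp : ∀ d x, SHmap d sU (SHmap d p (SHmap d (subsetIncl U) x)) = x := fun d x => by
    rw [SHmap_SHmap, SHmap_SHmap, SHmap_eq_of_homotopic d (g := ContinuousMap.id U), SHmap_id]
    · rfl
    · refine homotopic_of_segment (isEmbedding_subset_subtype U) _ _ (fun z => rfl)
        fun z t ht => ?_
      have hz : 0 < z.1.1.2 := z.2
      have h : 0 < (1 - t) * 1 + t * z.1.1.2 := by
        rcases ht.1.eq_or_lt with h | h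
        · simp [← h]
        · nlinarith [mul_pos h hz, ht.2]
      exact ⟨⟨⟨(z.1.1.1, _), h.ne'⟩, h⟩, rfl⟩
  have sVp : ∀ d x, SHmap d sV (SHmap d p (SHmap d (subsetIncl V) x)) = x := fun d x => by
    rw [SHmap_SHmap, SHmap_SHmap, SHmap_eq_of_homotopic d (g := ContinuousMap.id V), SHmap_id]
    · rfl
    · refine homotopic_of_segment (isEmbedding_subset_subtype V) _ _ (fun z => rfl)
        fun z t ht => ?_
      have hz : z.1.1.2 < 0 := z.2
      have h : (1 - t) * -1 + t * z.1.1.2 < 0 := by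
        rcases ht.1.eq_or_lt with h | h
        · simp [← h]
        · nlinarith [mul_neg_of_pos_of_neg h hz, ht.2]
      exact ⟨⟨⟨(z.1.1.1, _), h.ne⟩, h⟩, rfl⟩
  have hs : ∀ d x, ∃ (a : SH d U) (b : SH d V),
      SHmap d (subsetIncl U) a + SHmap d (subsetIncl V) b = x := by
    rintro (_ | d) x
    · exact mayerVietoris_zero hUV x
    · obtain ⟨δ, hδ, -⟩ := mayerVietoris_connecting hU hV hUV d
      exact (hδ x).1 ((h0 d).elim _ _)
  intro d
  refine ⟨fun x => ⟨_, psU d x⟩, ?_⟩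
  let g : SH d B →ₗ[ℤ] SH d (Punctured B ℝ) :=
    SHmap d (subsetIncl U) ∘ₗ SHmap d sU - SHmap d (subsetIncl V) ∘ₗ SHmap d sV
  have hg : ∀ x, g x =
    SHmap d (subsetIncl U) (SHmap d sU x) - SHmap d (subsetIncl V) (SHmap d sV x) := fun x => rfl
  refine (hB d).submodule g (fun x => ?_) (fun x hx => ?_) fun x hx => ?_
  · rw [hg, LinearMap.mem_ker, map_sub, psU d x, psV d x, sub_self]
  · rw [hg, sub_eq_zero] at hx
    obtain ⟨c, hc, -⟩ := mayerVietoris_middle hU hV hUV d _ _ hx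
    rw [← psU d x, ← hc, (h0 d).elim c 0, map_zero, map_zero, map_zero]
  · obtain ⟨u, v, rfl⟩ := hs d x
    have hx' : SHmap d p (SHmap d (subsetIncl U) u) + SHmap d p (SHmap d (subsetIncl V) v) = 0 :=
      (map_add _ _ _).symm.trans hx
    refine ⟨SHmap d p (SHmap d (subsetIncl U) u), (hg _).trans ?_⟩
    rw [sUp, eq_neg_of_add_eq_zero_left hx', map_neg, sVp, map_neg, sub_neg_eq_add]

lemma HasKerBetti.punctured_prod_real {k : ℕ → ℕ} (h : HasKerBetti (puncturedProj B E) k) :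
    HasKerBetti (puncturedProj B (E × ℝ)) fun d => if d = 0 then 0 else k (d - 1) := by
  let U : Set (Punctured B (E × ℝ)) := {p | p.1.2.1 ≠ 0 ∨ 0 < p.1.2.2}
  let V : Set (Punctured B (E × ℝ)) := {p | p.1.2.1 ≠ 0 ∨ p.1.2.2 < 0}
  have hc : Continuous fun p : Punctured B (E × ℝ) => p.1.2.1 := by fun_prop
  have hc' : Continuous fun p : Punctured B (E × ℝ) => p.1.2.2 := by fun_prop
  have hU : IsOpen U := (isOpen_ne.preimage hc).union
    (isOpen_lt continuous_const hc')
  have hV : IsOpen V := (isOpen_ne.preimage hc).union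
    (isOpen_lt hc' continuous_const)
  have hUV : U ∪ V = Set.univ := by
    refine Set.eq_univ_of_forall fun p => ?_
    by_cases h₁ : p.1.2.1 = 0
    · rcases lt_trichotomy p.1.2.2 0 with h₂ | h₂ | h₂
      · exact Or.inr (Or.inr h₂)
      · exact absurd (Prod.ext h₁ h₂) p.2
      · exact Or.inl (Or.inr h₂)
    · exact Or.inl (Or.inl h₁)
  have hne : ∀ p : (U ∩ V : Set (Punctured B (E × ℝ))), p.1.1.2.1 ≠ 0 := fun p hp =>
    lt_asymm (a := (0 : ℝ)) (p.2.1.resolve_left (not_not.2 hp)) (p.2.2.resolve_left (not_not.2 hp))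
  refine HasKerBetti.suspension hU hV hUV _ ?_ ?_ ?_
  · let s : C(B, U) :=
      ⟨fun x => ⟨⟨(x, (0, 1)), by simp⟩, Or.inr (zero_lt_one (α := ℝ))⟩, by fun_prop⟩
    refine isHomologyIso_of_homotopic (g := s) ?_ ?_
    · refine homotopic_of_segment (isEmbedding_subset_subtype U) _ _ (fun z => rfl)
        fun z t ht => ?_
      have h : t • z.1.1.2.1 ≠ 0 ∨ 0 < (1 - t) * 1 + t * z.1.1.2.2 := by
        rcases ht.1.eq_or_lt with h | h
        · simp [← h]
        · refine z.2.imp (fun hz => smul_ne_zero h.ne' hz) fun hz => ?_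
          nlinarith [mul_pos h hz, ht.2]
      refine ⟨⟨⟨(z.1.1.1, (t • z.1.1.2.1, (1 - t) * 1 + t * z.1.1.2.2)), fun h0 => ?_⟩, h⟩, ?_⟩
      · have h0' := Prod.ext_iff.1 h0
        exact h.elim (fun h => h h0'.1) (fun h => h.ne' h0'.2)
      · simp [s, subsetIncl, puncturedProj, Prod.ext_iff]
    · exact ContinuousMap.Homotopic.refl _
  · let s : C(B, V) :=
      ⟨fun x => ⟨⟨(x, (0, -1)), by simp⟩, Or.inr (neg_one_lt_zero (R := ℝ))⟩, by fun_prop⟩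
    refine isHomologyIso_of_homotopic (g := s) ?_ ?_
    · refine homotopic_of_segment (isEmbedding_subset_subtype V) _ _ (fun z => rfl)
        fun z t ht => ?_
      have h : t • z.1.1.2.1 ≠ 0 ∨ (1 - t) * -1 + t * z.1.1.2.2 < 0 := by
        rcases ht.1.eq_or_lt with h | h
        · simp [← h]
        · refine z.2.imp (fun hz => smul_ne_zero h.ne' hz) fun hz => ?_
          nlinarith [mul_neg_of_pos_of_neg h hz, ht.2]
      refine ⟨⟨⟨(z.1.1.1, (t • z.1.1.2.1, (1 - t) * -1 + t * z.1.1.2.2)), fun h0 => ?_⟩, h⟩, ?_⟩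
      · have h0' := Prod.ext_iff.1 h0
        exact h.elim (fun h => h h0'.1) (fun h => h.ne h0'.2)
      · simp [s, subsetIncl, puncturedProj, Prod.ext_iff]
    · exact ContinuousMap.Homotopic.refl _
  · let f : C((U ∩ V : Set (Punctured B (E × ℝ))), Punctured B E) :=
      ⟨fun p => ⟨(p.1.1.1, p.1.1.2.1), hne p⟩, by fun_prop⟩
    let g : C(Punctured B E, (U ∩ V : Set (Punctured B (E × ℝ)))) :=
      ⟨fun p => ⟨⟨(p.1.1, (p.1.2, 0)), fun h => p.2 (Prod.ext_iff.1 h).1⟩,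
        Or.inl p.2, Or.inl p.2⟩, by fun_prop⟩
    refine h.comp_iso (f := f) (isHomologyIso_of_homotopic (g := g) ?_ ?_)
    · refine homotopic_of_segment (isEmbedding_subset_subtype _) _ _ (fun z => rfl)
        fun z t ht => ?_
      refine ⟨⟨⟨(z.1.1.1, (z.1.1.2.1, t * z.1.1.2.2)), fun h => hne z (Prod.ext_iff.1 h).1⟩,
        Or.inl (hne z), Or.inl (hne z)⟩, ?_⟩
      simp [f, g, Prod.ext_iff, ← add_smul]
    · exact ContinuousMap.Homotopic.refl _

lemma HasKerBetti.punctured_equiv {k : ℕ → ℕ} (h : HasKerBetti (puncturedProj B F) k)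
    (e : E ≃L[ℝ] F) : HasKerBetti (puncturedProj B E) k := by
  let f : C(Punctured B E, Punctured B F) :=
    ⟨fun p => ⟨(p.1.1, e p.1.2), by simpa using p.2⟩, by fun_prop⟩
  let g : C(Punctured B F, Punctured B E) :=
    ⟨fun p => ⟨(p.1.1, e.symm p.1.2), by simpa using p.2⟩, by fun_prop⟩
  refine h.comp_iso (f := f) (isHomologyIso_of_homotopic (g := g) ?_ ?_)
  · rw [show g.comp f = ContinuousMap.id _ from
      ContinuousMap.ext fun p => Subtype.ext (Prod.ext rfl (e.symm_apply_apply _))]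
  · rw [show f.comp g = ContinuousMap.id _ from
      ContinuousMap.ext fun p => Subtype.ext (Prod.ext rfl (e.apply_symm_apply _))]

lemma hasKerBetti_punctured {b : ℕ → ℕ} (hB : HasBetti B b) (m : ℕ) :
    HasKerBetti (puncturedProj B (EuclideanSpace ℝ (Fin (m + 1))))
      fun d => if d < m then 0 else b (d - m) := by
  induction m with
  | zero =>
    exact (hasKerBetti_punctured_real hB).punctured_equiv
      (ContinuousLinearEquiv.ofFinrankEq (by simp))
  | succ m ih =>
    have h := ih.punctured_prod_real.punctured_equiv
      (ContinuousLinearEquiv.ofFinrankEq (by simp) :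
        EuclideanSpace ℝ (Fin (m + 1 + 1)) ≃L[ℝ] EuclideanSpace ℝ (Fin (m + 1)) × ℝ)
    convert h using 2 with d
    rcases d with _ | d
    · simp
    · simp [Nat.succ_sub_succ]

end Punctured

section Sections

variable {B E : Type} [TopologicalSpace B] [NormedAddCommGroup E] [NormedSpace ℝ E]

/-- The complement in `B × E` of the graphs of finitely many maps. -/
abbrev SectionCompl {m : ℕ} (s : Fin m → C(B, E)) : Type :=
  {p : B × E // ∀ i, p.2 ≠ s i p.1}

lemma exists_continuous_pos_le {m : ℕ} (f : Fin m → C(B, ℝ)) (hf : ∀ i x, 0 < f i x) :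
    ∃ ε : C(B, ℝ), (∀ x, 0 < ε x) ∧ ∀ i x, ε x ≤ f i x := by
  induction m with
  | zero => exact ⟨1, fun _ => one_pos, fun i => i.elim0⟩
  | succ m ih =>
    obtain ⟨ε, h₁, h₂⟩ := ih (fun i => f i.castSucc) fun i => hf _
    refine ⟨ε ⊓ f (Fin.last m), fun x => lt_min (h₁ x) (hf _ x), fun i x => ?_⟩
    induction i using Fin.lastCases with
    | last => exact min_le_right _ _
    | cast i => exact (min_le_left _ _).trans (h₂ i x)

lemma HasBetti.sectionCompl_zero {b : ℕ → ℕ} (hB : HasBetti B b) (s : Fin 0 → C(B, E)) :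
    HasBetti (SectionCompl s) b := by
  let f : C(B, SectionCompl s) := ⟨fun x => ⟨(x, 0), fun i => i.elim0⟩, by fun_prop⟩
  let g : C(SectionCompl s, B) := ⟨fun p => p.1.1, by fun_prop⟩
  refine hB.of_iso (f := f) (isHomologyIso_of_homotopic (g := g) ?_ ?_)
  · exact ContinuousMap.Homotopic.refl _
  · exact homotopic_of_segment (Topology.IsEmbedding.subtypeVal) _ _ (fun z => rfl)
      fun z t ht => ⟨⟨_, fun i => i.elim0⟩, rfl⟩

/-- Removing a section which avoids the previous ones. -/
lemma HasBetti.compl_section {b k : ℕ → ℕ} (hk : HasKerBetti (puncturedProj B E) k) {m : ℕ}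
    (s : Fin m → C(B, E)) (σ : C(B, E)) (hs : ∀ i x, s i x ≠ σ x)
    (h : HasBetti (SectionCompl s) b) :
    HasBetti {p : SectionCompl s | p.1.2 ≠ σ p.1.1} fun d => b d + k d := by
  obtain ⟨ε, hε, hle⟩ := exists_continuous_pos_le
    (fun i : Fin m => (⟨fun x => ‖s i x - σ x‖, by fun_prop⟩ : C(B, ℝ)))
    fun i x => norm_pos_iff.2 (sub_ne_zero.2 (hs i x))
  have hX : ∀ x y, ‖y - σ x‖ < ε x → ∀ i : Fin m, y ≠ s i x := by
    rintro x _ h i rfl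
    exact (hle i x).not_gt h
  let U : Set (SectionCompl s) := {p | p.1.2 ≠ σ p.1.1}
  let V : Set (SectionCompl s) := {p | ‖p.1.2 - σ p.1.1‖ < ε p.1.1}
  have c₁ : Continuous fun p : SectionCompl s => σ p.1.1 := by fun_prop
  have c₂ : Continuous fun p : SectionCompl s => p.1.2 := by fun_prop
  have c₃ : Continuous fun p : SectionCompl s => ε p.1.1 := by fun_prop
  have hU : IsOpen U := isOpen_ne_fun c₂ c₁
  have hV : IsOpen V := isOpen_lt (c₂.sub c₁).norm c₃
  have hUV : U ∪ V = Set.univ := by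
    refine Set.eq_univ_of_forall fun p => ?_
    by_cases hp : p.1.2 = σ p.1.1
    · refine Or.inr ?_
      change ‖p.1.2 - σ p.1.1‖ < ε p.1.1
      rw [hp, sub_self, norm_zero]
      exact hε _
    · exact Or.inl hp
  have hσ : ∀ x, ‖σ x - σ x‖ < ε x := fun x => by simpa using hε x
  let pV : C(V, B) := ⟨fun p => p.1.1.1, by fun_prop⟩
  have hpV : IsHomologyIso pV := by
    let g : C(B, V) := ⟨fun x => ⟨⟨(x, σ x), hX _ _ (hσ x)⟩, hσ x⟩, by fun_prop⟩
    refine isHomologyIso_of_homotopic (g := g) ?_ ?_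
    · refine homotopic_of_segment (isEmbedding_subset_subtype V) _ _ (fun z => rfl)
        fun z t ht => ?_
      have hz : ‖z.1.1.2 - σ z.1.1.1‖ < ε z.1.1.1 := z.2
      have ht' : ‖(1 - t) • σ z.1.1.1 + t • z.1.1.2 - σ z.1.1.1‖ < ε z.1.1.1 := by
        have : (1 - t) • σ z.1.1.1 + t • z.1.1.2 - σ z.1.1.1 = t • (z.1.1.2 - σ z.1.1.1) := by
          module
        rw [this, norm_smul, Real.norm_of_nonneg ht.1]
        exact (mul_le_of_le_one_left (norm_nonneg _) ht.2).trans_lt hz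
      exact ⟨⟨⟨(z.1.1.1, _), hX _ _ ht'⟩, ht'⟩, rfl⟩
    · exact ContinuousMap.Homotopic.refl _
  let q : C(U, Punctured B E) :=
    ⟨fun p => ⟨(p.1.1.1, p.1.1.2 - σ p.1.1.1), sub_ne_zero.2 p.2⟩, by fun_prop⟩
  have hq : IsHomologyIso (q.comp (subsetMap (Set.inter_subset_left : U ∩ V ⊆ U))) := by
    have hr : ∀ x (v : E), 0 < ε x / (1 + ‖v‖) := fun x v => div_pos (hε x) (by positivity)
    have hg : ∀ x (v : E), ‖σ x + (ε x / (1 + ‖v‖)) • v - σ x‖ < ε x := fun x v => by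
      rw [add_sub_cancel_left, norm_smul, Real.norm_of_nonneg (hr x v).le, div_mul_eq_mul_div,
        div_lt_iff₀ (by positivity)]
      exact mul_lt_mul_of_pos_left (lt_one_add _) (hε x)
    have hc : Continuous fun p : Punctured B E =>
        σ p.1.1 + (ε p.1.1 / (1 + ‖p.1.2‖)) • p.1.2 := by
      have : ∀ p : Punctured B E, 1 + ‖p.1.2‖ ≠ 0 := fun p => by positivity
      fun_prop (disch := assumption)
    let g : C(Punctured B E, (U ∩ V : Set (SectionCompl s))) :=
      ⟨fun p => ⟨⟨(p.1.1, σ p.1.1 + (ε p.1.1 / (1 + ‖p.1.2‖)) • p.1.2), hX _ _ (hg _ _)⟩,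
        fun h => smul_ne_zero (hr _ _).ne' p.2 (left_eq_add.1 h.symm), hg _ _⟩,
        ((by fun_prop : Continuous fun p : Punctured B E => p.1.1).prodMk hc).subtype_mk _
          |>.subtype_mk _⟩
    have hcoef : ∀ x (v : E), ∀ t ∈ Set.Icc (0 : ℝ) 1,
        0 < (1 - t) * (ε x / (1 + ‖v‖)) + t := fun x v t ht => by
      rcases ht.1.eq_or_lt with h | h
      · rw [← h]
        simpa using hr x v
      · exact add_pos_of_nonneg_of_pos (mul_nonneg (sub_nonneg.2 ht.2) (hr x v).le) h
    refine isHomologyIso_of_homotopic (g := g) ?_ ?_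
    · refine homotopic_of_segment (isEmbedding_subset_subtype _) _ _ (fun z => rfl)
        fun z t ht => ?_
      set x := z.1.1.1
      set y := z.1.1.2
      have hz₁ : y - σ x ≠ 0 := sub_ne_zero.2 z.2.1
      have hz₂ : ‖y - σ x‖ < ε x := z.2.2
      set r := ε x / (1 + ‖y - σ x‖)
      have he : (1 - t) • (σ x + r • (y - σ x)) + t • y =
          σ x + ((1 - t) * r + t) • (y - σ x) := by module
      have h₁ : (1 - t) • (σ x + r • (y - σ x)) + t • y ≠ σ x := fun h => by
        rw [he] at h
        exact smul_ne_zero (hcoef x _ t ht).ne' hz₁ (left_eq_add.1 h.symm)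
      have h₂ : ‖(1 - t) • (σ x + r • (y - σ x)) + t • y - σ x‖ < ε x := by
        have h₃ := hg x (y - σ x)
        rw [add_sub_cancel_left, norm_smul, Real.norm_of_nonneg (hr x _).le] at h₃
        rw [he, add_sub_cancel_left, norm_smul, Real.norm_of_nonneg (hcoef x _ t ht).le]
        rcases ht.1.eq_or_lt with h | h
        · rw [← h]
          simpa using h₃
        · nlinarith [mul_lt_mul_of_pos_left hz₂ h,
            mul_le_mul_of_nonneg_left h₃.le (sub_nonneg.2 ht.2)]
      exact ⟨⟨⟨(x, _), hX _ _ h₂⟩, h₁, h₂⟩, rfl⟩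
    · refine homotopic_of_segment (Topology.IsEmbedding.subtypeVal) _ _ (fun z => rfl)
        fun z t ht => ?_
      refine ⟨⟨(z.1.1, ((1 - t) * (ε z.1.1 / (1 + ‖z.1.2‖)) + t) • z.1.2),
        smul_ne_zero (hcoef _ _ t ht).ne' z.2⟩, Prod.ext rfl ?_⟩
      change _ = (1 - t) • (σ z.1.1 + (ε z.1.1 / (1 + ‖z.1.2‖)) • z.1.2 - σ z.1.1) + t • z.1.2
      module
  exact (hasKerBetti_subsetIncl hU hV hUV pV hpV q hq _ hk rfl).hasBetti h

lemma HasBetti.sectionCompl_succ {b k : ℕ → ℕ} (hk : HasKerBetti (puncturedProj B E) k) {m : ℕ}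
    (s : Fin (m + 1) → C(B, E)) (hs : ∀ i j, i ≠ j → ∀ x, s i x ≠ s j x)
    (h : HasBetti (SectionCompl fun i : Fin m => s i.castSucc) b) :
    HasBetti (SectionCompl s) fun d => b d + k d :=
  (HasBetti.compl_section hk _ (s (Fin.last m))
    (fun i => hs _ _ (Fin.castSucc_lt_last i).ne) h).of_homeomorph
    { toFun := fun p => ⟨p.1.1, Fin.lastCases p.2 p.1.2⟩
      invFun := fun p => ⟨⟨p.1, fun i => p.2 i.castSucc⟩, p.2 (Fin.last m)⟩
      left_inv := fun p => rfl
      right_inv := fun p => rfl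
      continuous_toFun := by fun_prop
      continuous_invFun := by fun_prop }

lemma HasBetti.sectionCompl {b k : ℕ → ℕ} (hB : HasBetti B b)
    (hk : HasKerBetti (puncturedProj B E) k) {m : ℕ} (s : Fin m → C(B, E))
    (hs : ∀ i j, i ≠ j → ∀ x, s i x ≠ s j x) :
    HasBetti (SectionCompl s) fun d => b d + m * k d := by
  induction m with
  | zero => simpa using hB.sectionCompl_zero s
  | succ m ih =>
    have h := HasBetti.sectionCompl_succ hk s hs
      (ih _ fun i j hij => hs _ _ fun h => hij (Fin.castSucc_injective m h))
    convert h using 2 with d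
    ring

end Sections

section Configurations

/-- The Poincaré polynomial of the configuration space. -/
noncomputable def confPolynomial (r n : ℕ) : Polynomial ℕ :=
  ∏ k ∈ Finset.range n, (Polynomial.C (r + k) * Polynomial.X + 1)

lemma confPolynomial_succ (r n : ℕ) : confPolynomial r (n + 1) =
    confPolynomial r n * (Polynomial.C (r + n) * Polynomial.X + 1) :=
  Finset.prod_range_succ _ _

lemma confPolynomial_succ_coeff_zero (r n : ℕ) :
    (confPolynomial r (n + 1)).coeff 0 = (confPolynomial r n).coeff 0 := by
  simp [confPolynomial_succ, Polynomial.mul_coeff_zero]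

lemma confPolynomial_succ_coeff_succ (r n j : ℕ) : (confPolynomial r (n + 1)).coeff (j + 1) =
    (confPolynomial r n).coeff (j + 1) + (r + n) * (confPolynomial r n).coeff j := by
  rw [confPolynomial_succ, mul_add, mul_one, Polynomial.coeff_add, mul_left_comm,
    Polynomial.coeff_C_mul, Polynomial.coeff_mul_X, add_comm]

lemma confPolynomial_coeff_eq_zero (r : ℕ) {n j : ℕ} (h : n < j) :
    (confPolynomial r n).coeff j = 0 := by
  refine Polynomial.coeff_eq_zero_of_natDegree_lt (lt_of_le_of_lt ?_ h)
  refine (Polynomial.natDegree_prod_le _ _).trans ((Finset.sum_le_card_nsmul _ _ 1 ?_).trans ?_)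
  · intro k _
    compute_degree
  · simp

/-- The ranks of the homology groups of the configuration space. -/
noncomputable def confBetti (D r n d : ℕ) : ℕ :=
  if D ∣ d then (confPolynomial r n).coeff (d / D) else 0

lemma confBetti_succ {D : ℕ} (hD : 0 < D) (r n d : ℕ) : confBetti D r (n + 1) d =
    confBetti D r n d + (r + n) * (if d < D then 0 else confBetti D r n (d - D)) := by
  unfold confBetti
  by_cases hd : d < D
  · rw [if_pos hd, Nat.div_eq_of_lt hd, confPolynomial_succ_coeff_zero, mul_zero, add_zero]
  · obtain ⟨e, rfl⟩ := Nat.exists_eq_add_of_le (not_lt.1 hd)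
    rw [if_neg hd, Nat.add_sub_cancel_left, Nat.add_div_left _ hD,
      confPolynomial_succ_coeff_succ]
    simp only [Nat.dvd_add_right (dvd_refl D)]
    split_ifs <;> simp

variable {r N : ℕ}

lemma continuous_conf_apply {n : ℕ} {q : Fin r → EuclideanSpace ℝ (Fin N)} (j : Fin n) :
    Continuous fun x : confComplement n r N q => x.1 j :=
  (continuous_apply j).comp continuous_subtype_val

/-- The forbidden positions of an additional point. -/
def confSection (q : Fin r → EuclideanSpace ℝ (Fin N)) (n : ℕ) :
    Fin (r + n) → C(confComplement n r N q, EuclideanSpace ℝ (Fin N)) :=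
  Fin.append (fun i => ContinuousMap.const _ (q i)) fun j =>
    ⟨fun x => (x.1 j).1, continuous_subtype_val.comp (continuous_conf_apply j)⟩

lemma confSection_ne {q : Fin r → EuclideanSpace ℝ (Fin N)} (hq : Function.Injective q) (n : ℕ)
    (i j : Fin (r + n)) (hij : i ≠ j) (x : confComplement n r N q) :
    confSection q n i x ≠ confSection q n j x := by
  induction i using Fin.addCases with
  | left i =>
    induction j using Fin.addCases with
    | left j =>
      simp only [confSection, Fin.append_left, ContinuousMap.const_apply]
      exact fun h => hij (congrArg _ (hq h))
    | right j =>
      simp only [confSection, Fin.append_left, Fin.append_right, ContinuousMap.const_apply]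
      exact fun h => (x.1 j).2 ⟨i, h⟩
  | right i =>
    induction j using Fin.addCases with
    | left j =>
      simp only [confSection, Fin.append_left, Fin.append_right, ContinuousMap.const_apply]
      exact fun h => (x.1 i).2 ⟨j, h.symm⟩
    | right j =>
      simp only [confSection, Fin.append_right]
      exact fun h => x.2 i j (fun h' => hij (congrArg _ h')) (Subtype.ext h)

lemma forall_ne_confSection_iff {q : Fin r → EuclideanSpace ℝ (Fin N)} {n : ℕ}
    {x : confComplement n r N q} {y : EuclideanSpace ℝ (Fin N)} :
    (∀ i, y ≠ confSection q n i x) ↔ y ∉ Set.range q ∧ ∀ j, y ≠ (x.1 j).1 := by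
  constructor
  · refine fun h => ⟨?_, fun j => ?_⟩
    · rintro ⟨i, rfl⟩
      exact h (Fin.castAdd n i) (by simp [confSection])
    · exact fun h' => h (Fin.natAdd r j) (by simp [confSection, h'])
  · rintro ⟨h₁, h₂⟩ i
    induction i using Fin.addCases with
    | left i =>
      simp only [confSection, Fin.append_left, ContinuousMap.const_apply]
      exact fun h => h₁ ⟨i, h.symm⟩
    | right i =>
      simp only [confSection, Fin.append_right]
      exact h₂ i

/-- Adding one more point to a configuration. -/
def confHomeomorph (q : Fin r → EuclideanSpace ℝ (Fin N)) (n : ℕ) :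
    SectionCompl (confSection q n) ≃ₜ confComplement (n + 1) r N q where
  toFun p := ⟨Fin.snoc (α := fun _ => {y // y ∉ Set.range q}) p.1.1.1
      ⟨p.1.2, (forall_ne_confSection_iff.1 p.2).1⟩, by
    have h := (forall_ne_confSection_iff.1 p.2).2
    intro i j hij
    induction i using Fin.lastCases with
    | last =>
      induction j using Fin.lastCases with
      | last => exact absurd rfl hij
      | cast j =>
        rw [Fin.snoc_last, Fin.snoc_castSucc]
        exact fun h' => h j (congrArg Subtype.val h')
    | cast i =>
      induction j using Fin.lastCases with
      | last =>
        rw [Fin.snoc_last, Fin.snoc_castSucc]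
        exact fun h' => h i (congrArg Subtype.val h'.symm)
      | cast j =>
        rw [Fin.snoc_castSucc, Fin.snoc_castSucc]
        exact p.1.1.2 i j fun h' => hij (congrArg _ h')⟩
  invFun x := ⟨(⟨fun i => x.1 i.castSucc, fun i j hij => x.2 _ _ fun h =>
      hij (Fin.castSucc_injective n h)⟩, (x.1 (Fin.last n)).1),
    forall_ne_confSection_iff.2 ⟨(x.1 (Fin.last n)).2, fun j h =>
      x.2 _ _ (Fin.castSucc_lt_last j).ne' (Subtype.ext h)⟩⟩
  left_inv p := by
    refine Subtype.ext (Prod.ext (Subtype.ext (funext fun i => ?_)) ?_)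
    · exact Fin.snoc_castSucc (α := fun _ => {y // y ∉ Set.range q}) _ _ i
    · exact congrArg Subtype.val (Fin.snoc_last (α := fun _ => {y // y ∉ Set.range q}) _ _)
  right_inv x := Subtype.ext (Fin.snoc_init_self x.1)
  continuous_toFun := by
    refine Continuous.subtype_mk ?_ _
    refine Continuous.finSnoc ?_ ?_ <;> fun_prop
  continuous_invFun := by
    refine Continuous.subtype_mk (Continuous.prodMk (Continuous.subtype_mk ?_ _) ?_) _
    · exact continuous_pi fun i => continuous_conf_apply _
    · exact continuous_subtype_val.comp (continuous_conf_apply _)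

lemma hasBetti_confComplement {D : ℕ} (hD : 0 < D)
    {q : Fin r → EuclideanSpace ℝ (Fin (D + 1))} (hq : Function.Injective q) (n : ℕ) :
    HasBetti (confComplement n r (D + 1) q) (confBetti D r n) := by
  induction n with
  | zero =>
    let _ : Unique (confComplement 0 r (D + 1) q) :=
      { default := ⟨fun i => i.elim0, fun i => i.elim0⟩
        uniq := fun x => Subtype.ext (funext fun i => i.elim0) }
    convert hasBetti_of_unique (X := confComplement 0 r (D + 1) q) using 2 with d
    unfold confBetti confPolynomial
    rw [Finset.range_zero, Finset.prod_empty, Polynomial.coeff_one]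
    rcases Nat.eq_zero_or_pos d with rfl | hd
    · simp
    · rw [if_neg hd.ne']
      refine ite_eq_right_iff.2 fun h => if_neg ?_
      exact (Nat.div_pos (Nat.le_of_dvd hd h) hD).ne'
  | succ n ih =>
    convert (ih.sectionCompl (hasKerBetti_punctured ih D) (confSection q n)
      (confSection_ne hq n)).of_homeomorph (confHomeomorph q n) using 2 with d
    exact confBetti_succ hD r n d

end Configurations

theorem stmt18 (n r N : ℕ) (hn : 1 ≤ n) (hr : 1 ≤ r) (hN : 2 ≤ N)
    (q : Fin r → EuclideanSpace ℝ (Fin N)) (hq : Function.Injective q) :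
    (∀ d : ℕ, Module.Free ℤ (SH d (confComplement n r N q))) ∧
    (∀ d : ℕ, (∀ j : ℕ, j ≤ n → d ≠ j * (N - 1)) →
      Subsingleton (SH d (confComplement n r N q))) ∧
    (∀ j : ℕ, j ≤ n →
      Module.Finite ℤ (SH (j * (N - 1)) (confComplement n r N q)) ∧
      Module.finrank ℤ (SH (j * (N - 1)) (confComplement n r N q)) =
        (∏ k ∈ Finset.range n,
          (Polynomial.C (r + k) * Polynomial.X + 1 : Polynomial ℕ)).coeff j) := by
  obtain ⟨D, rfl⟩ := Nat.exists_eq_add_of_le' (one_le_two.trans hN)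
  have hD : 0 < D := by omega
  have h := hasBetti_confComplement hD hq n
  rw [Nat.add_sub_cancel]
  refine ⟨fun d => (h d).1, fun d hd => ?_, fun j _ => ⟨(h _).2.1, (h _).2.2.trans ?_⟩⟩
  · have h0 : confBetti D r n d = 0 := by
      refine ite_eq_right_iff.2 ?_
      rintro ⟨j, rfl⟩
      rw [Nat.mul_div_cancel_left _ hD]
      exact confPolynomial_coeff_eq_zero r (not_le.1 fun hj => hd j hj (mul_comm _ _))
    exact (h0 ▸ h d).subsingleton
  · rw [confBetti, if_pos (dvd_mul_left _ _), Nat.mul_div_cancel _ hD, confPolynomial]
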